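/- arXiv:1410.0659 — 8 statements merged into one kernel-verified Lean document; each statement's English description precedes it below -/
import Mathlib

section
/- For every real number t, the determinant of H(e^{it}) equals ((1−√5) − (1+√5)·cos t)/8; in particular, det H(e^{it}) < 0 if and only if cos t > (√5−3)/2. -/
open Matrix

/-- The Hermitian form of a complex hyperbolic (3,3,5)-triangle group with
angular invariant `arg φ`. -/
noncomputable def H (φ : ℂ) : Matrix (Fin 3) (Fin 3) ℂ :=
  !![1, -1/2, -(((1 + Real.sqrt 5) / 4 : ℝ) : ℂ) * φ;
     -1/2, 1, -1/2;
     -(((1 + Real.sqrt 5) / 4 : ℝ) : ℂ) * (starRingEnd ℂ) φ, -1/2, 1]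

theorem det_H_exp (t : ℝ) :
    (H (Complex.exp (t * Complex.I))).det
        = ((((1 - Real.sqrt 5) - (1 + Real.sqrt 5) * Real.cos t) / 8 : ℝ) : ℂ) ∧
      ((((1 - Real.sqrt 5) - (1 + Real.sqrt 5) * Real.cos t) / 8 : ℝ) < 0 ↔
        Real.cos t > (Real.sqrt 5 - 3) / 2) := by
  have h5 : Real.sqrt 5 * Real.sqrt 5 = 5 := Real.mul_self_sqrt (by norm_num)
  refine ⟨?_, ?_⟩
  · have hsq := Real.sin_sq_add_cos_sq t
    rw [H, Matrix.det_fin_three, Complex.exp_mul_I, ← Complex.ofReal_cos, ← Complex.ofReal_sin]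
    generalize Real.cos t = c at *
    generalize Real.sin t = s at *
    generalize Real.sqrt 5 = r at *
    have h5' : (r : ℂ) * r = 5 := by exact_mod_cast h5
    have hsq' : (s : ℂ) ^ 2 + (c : ℂ) ^ 2 = 1 := by exact_mod_cast hsq
    simp only [Matrix.of_apply, Matrix.cons_val, map_add, map_mul, Complex.conj_ofReal,
      Complex.conj_I]
    push_cast
    linear_combination (-((1 + (r : ℂ)) / 4) ^ 2) * hsq' - h5' / 16
      + ((1 + (r : ℂ)) / 4) ^ 2 * (s : ℂ) ^ 2 * Complex.I_sq
  · have hfactor : ((1 - Real.sqrt 5) - (1 + Real.sqrt 5) * Real.cos t) / 8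
        = (1 + Real.sqrt 5) / 8 * ((Real.sqrt 5 - 3) / 2 - Real.cos t) := by
      linear_combination -h5 / 16
    rw [hfactor, ← smul_eq_mul, smul_neg_iff_of_pos_left (by positivity), sub_neg, gt_iff_lt]
end

section
/- The determinant of H(φ₀) equals −(1+√5)/16; in particular it is negative, so the Hermitian matrix H(φ₀) has signature (2,1). -/
open Matrix

/-- `s₀ = √(4√5 − 5)`. -/
noncomputable def s0 : ℝ := Real.sqrt (4 * Real.sqrt 5 - 5)

/-- `φ₀ = (√5 − 2 + i·s₀)/2`. -/
noncomputable def phi0 : ℂ := ((Real.sqrt 5 : ℂ) - 2 + Complex.I * (s0 : ℂ)) / 2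

theorem det_H (φ : ℂ) :
    (H φ).det =
      ((1 / 2 - ((1 + Real.sqrt 5) / 4) ^ 2 * Complex.normSq φ
        - (1 + Real.sqrt 5) / 8 * φ.re : ℝ) : ℂ) := by
  have hre : (φ.re : ℂ) = (φ + (starRingEnd ℂ) φ) / 2 := Complex.re_eq_add_conj φ
  push_cast
  rw [hre, Complex.normSq_eq_conj_mul_self, H, Matrix.det_fin_three]
  simp
  ring

theorem normSq_phi0 : Complex.normSq phi0 = 1 := by
  have h5 : Real.sqrt 5 ^ 2 = 5 := Real.sq_sqrt (by norm_num)
  have hs : s0 ^ 2 = 4 * Real.sqrt 5 - 5 :=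
    Real.sq_sqrt (by nlinarith [Real.sqrt_nonneg 5])
  have hphi : phi0 = ⟨(Real.sqrt 5 - 2) / 2, s0 / 2⟩ := by
    apply Complex.ext <;> simp [phi0]
  rw [hphi, Complex.normSq_mk]
  linear_combination (1 / 4) * h5 + (1 / 4) * hs

/-- A Hermitian form `H φ` of negative determinant has signature `(2,1)`: Gram–Schmidt on the
standard basis yields an orthonormal basis in which the form is `diag(1, 1, -1)`. -/
theorem exists_conjTranspose_mul_H_mul_eq_diagonal {φ : ℂ} {d : ℝ} (hd : d < 0)
    (hdet : (H φ).det = (d : ℂ)) :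
    ∃ P : Matrix (Fin 3) (Fin 3) ℂ, IsUnit P ∧
      Pᴴ * H φ * P = Matrix.diagonal ![1, 1, -1] := by
  obtain ⟨s, hs⟩ : ∃ s : ℝ, s ^ 2 = 4 / 3 := ⟨_, Real.sq_sqrt (by norm_num)⟩
  obtain ⟨t, ht⟩ : ∃ t : ℝ, t ^ 2 = 3 / (4 * -d) :=
    ⟨_, Real.sq_sqrt (div_nonneg (by norm_num) (by linarith))⟩
  have htd : t ^ 2 * d = -3 / 4 := by
    rw [ht]; field_simp [hd.ne]
  have hs0 : s ≠ 0 := by rintro rfl; norm_num at hs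
  have ht0 : t ≠ 0 := by rintro rfl; norm_num at htd
  have hsC : (s : ℂ) ^ 2 = 4 / 3 := by
    rw [← Complex.ofReal_pow, hs]; norm_num
  have htC : (t : ℂ) ^ 2 * (H φ).det = -3 / 4 := by
    rw [hdet, ← Complex.ofReal_pow, ← Complex.ofReal_mul, htd]; norm_num
  rw [Matrix.det_fin_three] at htC
  obtain ⟨a, ha⟩ : ∃ a : ℝ, a = (1 + Real.sqrt 5) / 4 := ⟨_, rfl⟩
  simp only [H, ← ha] at htC ⊢
  simp at htC
  refine ⟨!![1, s / 2, t * ((1 + 4 * (a * φ)) / 3); 0, s, t * ((2 + 2 * (a * φ)) / 3); 0, 0, t],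
    ?_, ?_⟩
  · rw [Matrix.isUnit_iff_isUnit_det, Matrix.det_fin_three]
    simp [hs0, ht0]
  · ext i j
    fin_cases i <;> fin_cases j <;>
      simp [Matrix.mul_apply, Fin.sum_univ_three, Complex.conj_ofNat]
    · ring
    · ring
    · ring
    · linear_combination (3 / 4) * hsC
    · ring
    · ring
    · ring
    · linear_combination (4 / 3) * htC

theorem det_H_phi0 :
    (H phi0).det = ((-(1 + Real.sqrt 5) / 16 : ℝ) : ℂ) ∧
      (-(1 + Real.sqrt 5) / 16 : ℝ) < 0 ∧
      ∃ P : Matrix (Fin 3) (Fin 3) ℂ, IsUnit P ∧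
        Pᴴ * H phi0 * P = Matrix.diagonal ![1, 1, -1] := by
  have hd : (-(1 + Real.sqrt 5) / 16 : ℝ) < 0 := by
    have := Real.sqrt_nonneg 5
    linarith
  have hdet : (H phi0).det = ((-(1 + Real.sqrt 5) / 16 : ℝ) : ℂ) := by
    have h5 : Real.sqrt 5 ^ 2 = 5 := Real.sq_sqrt (by norm_num)
    have hre : phi0.re = (Real.sqrt 5 - 2) / 2 := by simp [phi0]
    rw [det_H, normSq_phi0, hre]
    congr 1
    linear_combination (-1 / 8) * h5
  exact ⟨hdet, hd, exists_conjTranspose_mul_H_mul_eq_diagonal hd hdet⟩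
end

section
/- Each of the matrices I₁, I₂, I₃ is an involution preserving the Hermitian form H(φ₀): for k = 1,2,3 one has I_k² = 1 (the 3×3 identity matrix) and I_kᴴ · H(φ₀) · I_k = H(φ₀), where I_kᴴ denotes the conjugate transpose of I_k. -/
open Matrix

/-- `α₀ = −1 + (1+√5)(1 − i·s₀)/4`. -/
noncomputable def alpha0 : ℂ :=
  -1 + (1 + (Real.sqrt 5 : ℂ)) * (1 - Complex.I * (s0 : ℂ)) / 4

/-- Generating complex reflections of the (3,3,5;∞)-triangle group. -/
noncomputable def I1 : Matrix (Fin 3) (Fin 3) ℂ :=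
  !![1, -1, alpha0; 0, -1, 0; 0, 0, -1]

noncomputable def I2 : Matrix (Fin 3) (Fin 3) ℂ :=
  !![-1, 0, 0; -1, 1, -1; 0, 0, -1]

noncomputable def I3 : Matrix (Fin 3) (Fin 3) ℂ :=
  !![-1, 0, 0; 0, -1, 0; (starRingEnd ℂ) alpha0, -1, 1]

theorem mul_phi0_eq_alpha0_div_two :
    -(((1 + Real.sqrt 5) / 4 : ℝ) : ℂ) * phi0 = alpha0 / 2 := by
  have h5 : (Real.sqrt 5 : ℂ) ^ 2 = 5 := by
    rw [← Complex.ofReal_pow, Real.sq_sqrt (by norm_num)]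
    norm_num
  simp only [phi0, alpha0]
  push_cast
  linear_combination (-1 / 8 : ℂ) * h5

theorem H_phi0_eq :
    H phi0 = !![1, -1/2, alpha0 / 2;
                -1/2, 1, -1/2;
                (starRingEnd ℂ) alpha0 / 2, -1/2, 1] := by
  have h := congrArg (starRingEnd ℂ) mul_phi0_eq_alpha0_div_two
  simp only [map_mul, map_neg, map_div₀, Complex.conj_ofReal, map_ofNat] at h
  simp only [H, mul_phi0_eq_alpha0_div_two, h]

theorem reflections_preserve_form :
    (I1 ^ 2 = 1 ∧ I1ᴴ * H phi0 * I1 = H phi0) ∧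
    (I2 ^ 2 = 1 ∧ I2ᴴ * H phi0 * I2 = H phi0) ∧
    (I3 ^ 2 = 1 ∧ I3ᴴ * H phi0 * I3 = H phi0) := by
  rw [H_phi0_eq]
  refine ⟨⟨?_, ?_⟩, ⟨?_, ?_⟩, ?_, ?_⟩ <;> ext i j <;> fin_cases i <;> fin_cases j <;>
    simp [I1, I2, I3, pow_two, Matrix.mul_apply, Fin.sum_univ_three] <;> ring
end

section
/- The group generated by I₁, I₂, I₃ is a (3,3,5)-triangle group: there exist complex numbers c₁, c₂, c₃ with c₁³ = c₂³ = c₃³ = 1 such that (I₁I₂)³ = c₁·1, (I₂I₃)³ = c₂·1, and (I₃I₁)⁵ = c₃·1 (scalar multiples of the 3×3 identity matrix), while none of the matrices (I₁I₂), (I₁I₂)², (I₂I₃), (I₂I₃)², (I₃I₁), (I₃I₁)², (I₃I₁)³, (I₃I₁)⁴ is a scalar multiple of the identity. -/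
open Matrix

/-- A matrix is scalar if it is a complex multiple of the identity. -/
def IsScalarMat (M : Matrix (Fin 3) (Fin 3) ℂ) : Prop :=
  ∃ c : ℂ, M = c • (1 : Matrix (Fin 3) (Fin 3) ℂ)

theorem vecMul_pow_eq_self {n R : Type*} [Fintype n] [DecidableEq n] [CommRing R]
    {M : Matrix n n R} {v : n → R} (h : v ᵥ* M = v) (k : ℕ) : v ᵥ* (M ^ k) = v := by
  induction k with
  | zero => simp
  | succ k ih => rw [pow_succ, ← vecMul_vecMul, ih, h]

/-- If `M ≠ 1` has order dividing `p` and fixes a coordinate covector, then no power of `M` with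
exponent coprime to `p` is scalar. -/
theorem not_isScalarMat_pow {M : Matrix (Fin 3) (Fin 3) ℂ} {p k : ℕ} (i : Fin 3)
    (hrow : M i = Pi.single i 1) (hM : M ≠ 1) (hp : M ^ p = 1) (hk : k.Coprime p) :
    ¬ IsScalarMat (M ^ k) := by
  rintro ⟨c, hc⟩
  have hfix : Pi.single i 1 ᵥ* M = Pi.single i 1 := by
    rw [single_one_vecMul]
    exact hrow
  have hpow := congrFun (vecMul_pow_eq_self hfix k) i
  have hc1 : c = 1 := by simpa [hc] using hpow
  rw [hc1, one_smul] at hc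
  apply hM
  rw [← pow_one M, ← hk.gcd_eq_one]
  exact pow_gcd_eq_one.2 ⟨hc, hp⟩

theorem sqrt_five_sq : (Real.sqrt 5 : ℂ) ^ 2 = 5 := by
  exact_mod_cast Real.sq_sqrt (show (0 : ℝ) ≤ 5 by norm_num)

theorem s0_sq : (s0 : ℂ) ^ 2 = 4 * (Real.sqrt 5 : ℂ) - 5 := by
  have h : (0 : ℝ) ≤ 4 * Real.sqrt 5 - 5 := by
    have : (2 : ℝ) ≤ Real.sqrt 5 := Real.le_sqrt_of_sq_le (by norm_num)
    linarith
  exact_mod_cast Real.sq_sqrt h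

/-- `|α₀|²` is the square of the golden ratio. -/
theorem alpha0_mul_conj :
    alpha0 * (starRingEnd ℂ) alpha0 = (3 + (Real.sqrt 5 : ℂ)) / 2 := by
  simp only [alpha0, map_add, map_sub, map_mul, map_neg, map_div₀, map_one, map_ofNat,
    Complex.conj_I, Complex.conj_ofReal]
  have h5 := sqrt_five_sq
  have hs := s0_sq
  have hI := Complex.I_sq
  grind

theorem I1_mul_I2 : I1 * I2 = !![0, -1, 1 - alpha0; 1, -1, 1; 0, 0, 1] := by
  ext i j
  fin_cases i <;> fin_cases j <;> simp [I1, I2, mul_apply, Fin.sum_univ_three]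
  ring

theorem I2_mul_I3 :
    I2 * I3 = !![1, 0, 0; 1 - (starRingEnd ℂ) alpha0, 0, -1; -(starRingEnd ℂ) alpha0, 1, -1] := by
  ext i j
  fin_cases i <;> fin_cases j <;> simp [I2, I3, mul_apply, Fin.sum_univ_three]
  ring

theorem I3_mul_I1 :
    I3 * I1 = !![-1, 1, -alpha0; 0, 1, 0;
      (starRingEnd ℂ) alpha0, 1 - (starRingEnd ℂ) alpha0, (1 + (Real.sqrt 5 : ℂ)) / 2] := by
  have h := alpha0_mul_conj
  ext i j
  fin_cases i <;> fin_cases j <;> simp [I1, I3, mul_apply, Fin.sum_univ_three] <;> grind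

theorem I1_mul_I2_pow_three : (I1 * I2) ^ 3 = 1 := by
  rw [I1_mul_I2]
  ext i j
  fin_cases i <;> fin_cases j <;> simp [pow_succ, mul_apply, Fin.sum_univ_three]
  ring

theorem I2_mul_I3_pow_three : (I2 * I3) ^ 3 = 1 := by
  rw [I2_mul_I3]
  ext i j
  fin_cases i <;> fin_cases j <;> simp [pow_succ, mul_apply, Fin.sum_univ_three]

theorem I3_mul_I1_pow_five : (I3 * I1) ^ 5 = 1 := by
  have h := alpha0_mul_conj
  have h5 := sqrt_five_sq
  rw [I3_mul_I1]
  ext i j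
  fin_cases i <;> fin_cases j <;> simp [pow_succ, mul_apply, Fin.sum_univ_three] <;> grind

theorem triangle_group_relations :
    (∃ c1 c2 c3 : ℂ, c1 ^ 3 = 1 ∧ c2 ^ 3 = 1 ∧ c3 ^ 3 = 1 ∧
      (I1 * I2) ^ 3 = c1 • (1 : Matrix (Fin 3) (Fin 3) ℂ) ∧
      (I2 * I3) ^ 3 = c2 • (1 : Matrix (Fin 3) (Fin 3) ℂ) ∧
      (I3 * I1) ^ 5 = c3 • (1 : Matrix (Fin 3) (Fin 3) ℂ)) ∧
    ¬ IsScalarMat (I1 * I2) ∧ ¬ IsScalarMat ((I1 * I2) ^ 2) ∧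
    ¬ IsScalarMat (I2 * I3) ∧ ¬ IsScalarMat ((I2 * I3) ^ 2) ∧
    ¬ IsScalarMat (I3 * I1) ∧ ¬ IsScalarMat ((I3 * I1) ^ 2) ∧
    ¬ IsScalarMat ((I3 * I1) ^ 3) ∧ ¬ IsScalarMat ((I3 * I1) ^ 4) := by
  have h12 (k : ℕ) (hk : k.Coprime 3) : ¬ IsScalarMat ((I1 * I2) ^ k) := by
    refine not_isScalarMat_pow 2 ?_ (fun h => ?_) I1_mul_I2_pow_three hk
    · ext j
      fin_cases j <;> simp [I1_mul_I2]
    · simpa [I1_mul_I2] using congrFun₂ h 0 0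
  have h23 (k : ℕ) (hk : k.Coprime 3) : ¬ IsScalarMat ((I2 * I3) ^ k) := by
    refine not_isScalarMat_pow 0 ?_ (fun h => ?_) I2_mul_I3_pow_three hk
    · ext j
      fin_cases j <;> simp [I2_mul_I3]
    · simpa [I2_mul_I3] using congrFun₂ h 1 1
  have h31 (k : ℕ) (hk : k.Coprime 5) : ¬ IsScalarMat ((I3 * I1) ^ k) := by
    refine not_isScalarMat_pow 1 ?_ (fun h => ?_) I3_mul_I1_pow_five hk
    · ext j
      fin_cases j <;> simp [I3_mul_I1]
    · simpa [I3_mul_I1] using congrFun₂ h 0 1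
  refine ⟨⟨1, 1, 1, one_pow 3, one_pow 3, one_pow 3, ?_, ?_, ?_⟩,
    pow_one (I1 * I2) ▸ h12 1 (by norm_num), h12 2 (by norm_num),
    pow_one (I2 * I3) ▸ h23 1 (by norm_num), h23 2 (by norm_num),
    pow_one (I3 * I1) ▸ h31 1 (by norm_num), h31 2 (by norm_num),
    h31 3 (by norm_num), h31 4 (by norm_num)⟩
  · rw [I1_mul_I2_pow_three, one_smul]
  · rw [I2_mul_I3_pow_three, one_smul]
  · rw [I3_mul_I1_pow_five, one_smul]
end

section
/- In the abstract (3,3,5) von Dyck group D, the two elements x₁⁻¹x₂⁻¹ and x₁x₂⁻¹ generate the whole group: the subgroup closure of {x₁⁻¹x₂⁻¹, x₁x₂⁻¹} equals D. (These are the images of the generators a, d of π₁(m009) under the boundary-unipotent representation into the even-length subgroup of the (3,3,5;∞)-triangle group; hence that representation is onto.) -/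
/-- Relators of the abstract (3,3,5) von Dyck group. -/
def vonDyckRels : Set (FreeGroup (Fin 2)) :=
  {FreeGroup.of 0 ^ 3, FreeGroup.of 1 ^ 3,
   (FreeGroup.of 0 * FreeGroup.of 1) ^ 5}

/-- The abstract (3,3,5) von Dyck group. -/
abbrev D := PresentedGroup vonDyckRels

def x1 : D := PresentedGroup.of 0
def x2 : D := PresentedGroup.of 1

theorem x1_pow_three : x1 ^ 3 = 1 :=
  PresentedGroup.one_of_mem (rels := vonDyckRels) (Set.mem_insert _ _)

theorem m009_image_generates :
    Subgroup.closure ({x1⁻¹ * x2⁻¹, x1 * x2⁻¹} : Set D) = ⊤ := by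
  set H := Subgroup.closure ({x1⁻¹ * x2⁻¹, x1 * x2⁻¹} : Set D)
  have hu : x1⁻¹ * x2⁻¹ ∈ H := Subgroup.subset_closure (Set.mem_insert _ _)
  have hv : x1 * x2⁻¹ ∈ H := Subgroup.subset_closure (Set.mem_insert_of_mem _ rfl)
  have hx : x1 ∈ H := by
    have h : (x1 * x2⁻¹ * (x1⁻¹ * x2⁻¹)⁻¹)⁻¹ = x1 := by
      rw [show (x1 * x2⁻¹ * (x1⁻¹ * x2⁻¹)⁻¹)⁻¹ = (x1 ^ 3)⁻¹ * x1 by group, x1_pow_three]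
      simp
    exact h ▸ H.inv_mem (H.mul_mem hv (H.inv_mem hu))
  have hy : x2 ∈ H := H.inv_mem_iff.mp ((H.mul_mem_cancel_left hx).mp hv)
  rw [eq_top_iff, ← PresentedGroup.closure_range_of, Subgroup.closure_le]
  rintro _ ⟨i, rfl⟩
  fin_cases i
  · exact hx
  · exact hy
end

section
/- In the abstract (3,3,5) von Dyck group D, the two elements x₂x₁x₂ and (x₁x₂)² generate the whole group: the subgroup closure of {x₂x₁x₂, (x₁x₂)²} equals D. (These are the images of the generators a, b of π₁(m015) under the boundary-unipotent representation into the even-length subgroup of the (3,3,5;∞)-triangle group; hence that representation is onto.) -/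
theorem x1_mul_x2_pow_five : (x1 * x2) ^ 5 = 1 :=
  PresentedGroup.one_of_mem (rels := vonDyckRels)
    (x := (FreeGroup.of 0 * FreeGroup.of 1) ^ 5) (by simp [vonDyckRels])

theorem m015_image_generates :
    Subgroup.closure ({x2 * x1 * x2, (x1 * x2) ^ 2} : Set D) = ⊤ := by
  set H := Subgroup.closure ({x2 * x1 * x2, (x1 * x2) ^ 2} : Set D)
  have hu : x2 * x1 * x2 ∈ H := Subgroup.subset_closure (by simp)
  have hv : (x1 * x2) ^ 2 ∈ H := Subgroup.subset_closure (by simp)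
  have hc : x1 * x2 ∈ H := by
    have h : ((x1 * x2) ^ 2) ^ 3 = x1 * x2 := by
      rw [← pow_mul, pow_succ, x1_mul_x2_pow_five, one_mul]
    exact h ▸ H.pow_mem hv 3
  have h2 : x2 ∈ H := (H.mul_mem_cancel_right hc).1 (by rwa [← mul_assoc])
  have h1 : x1 ∈ H := (H.mul_mem_cancel_right h2).1 hc
  rw [eq_top_iff, ← PresentedGroup.closure_range_of, Subgroup.closure_le]
  rintro _ ⟨i, rfl⟩
  fin_cases i
  · exact h1
  · exact h2
end

section
/- There is an injective group homomorphism ρ from the abstract (3,3,5) von Dyck group D to the quotient of GL(3,ℂ) by its center, with ρ(x₁) the class of the matrix I₁I₂ and ρ(x₂) the class of the matrix I₂I₃. In other words, the subgroup Γ of PU(2,1) generated by I₁I₂ and I₂I₃ (the even-length subgroup of the (3,3,5;∞)-triangle group) has the presentation ⟨x₁, x₂ | x₁³, x₂³, (x₁x₂)⁵⟩. -/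
open Matrix

section Levels

variable {W : Type*} [Group W]

/-- `Reach a b c n g` says that `g` is a word in `a`, `b`, `c` using the letter `b` exactly
`n` times. -/
inductive Reach (a b c : W) : ℕ → W → Prop
  | one : Reach a b c 0 1
  | mul_a {n : ℕ} {g : W} : Reach a b c n g → Reach a b c n (g * a)
  | mul_c {n : ℕ} {g : W} : Reach a b c n g → Reach a b c n (g * c)
  | mul_b {n : ℕ} {g : W} : Reach a b c n g → Reach a b c (n + 1) (g * b)

/-- The minimal number of letters `b` in a word representing `g`. -/
noncomputable def level (a b c g : W) : ℕ := sInf {n | Reach a b c n g}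

/-- The alternating words in `a`, `c` of length at most five. -/
inductive Alt (a c : W) : W → Prop
  | e : Alt a c 1
  | a : Alt a c a
  | c : Alt a c c
  | ac : Alt a c (a * c)
  | ca : Alt a c (c * a)
  | aca : Alt a c (a * c * a)
  | cac : Alt a c (c * a * c)
  | acac : Alt a c (a * c * a * c)
  | caca : Alt a c (c * a * c * a)
  | acaca : Alt a c (a * c * a * c * a)

/-- The relations of the `(3, 3, 5)` triangle group, on generators `a`, `b`, `c`. -/
structure TriangleRels (a b c : W) : Prop where
  aa : a * a = 1
  bb : b * b = 1
  cc : c * c = 1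
  bab : b * a * b = a * b * a
  bcb : b * c * b = c * b * c
  cacac : c * a * c * a * c = a * c * a * c * a

variable {a b c : W}

lemma eq_of_alt {α : Type*} {f : W → α} (ha : ∀ g, f (g * a) = f g) (hc : ∀ g, f (g * c) = f g)
    (g : W) {k : W} (hk : Alt a c k) : f (g * k) = f g := by
  cases hk <;> simp only [← mul_assoc, mul_one, ha, hc]

namespace TriangleRels

lemma mul_aa (h : TriangleRels a b c) (x : W) : x * a * a = x := by
  rw [mul_assoc, h.aa, mul_one]

lemma mul_bb (h : TriangleRels a b c) (x : W) : x * b * b = x := by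
  rw [mul_assoc, h.bb, mul_one]

lemma mul_cc (h : TriangleRels a b c) (x : W) : x * c * c = x := by
  rw [mul_assoc, h.cc, mul_one]

lemma mul_bab (h : TriangleRels a b c) (x : W) : x * b * a * b = x * a * b * a := by
  simpa only [mul_assoc] using congrArg (x * ·) h.bab

lemma mul_bcb (h : TriangleRels a b c) (x : W) : x * b * c * b = x * c * b * c := by
  simpa only [mul_assoc] using congrArg (x * ·) h.bcb

lemma mul_cacac (h : TriangleRels a b c) (x : W) :
    x * c * a * c * a * c = x * a * c * a * c * a := by
  simpa only [mul_assoc] using congrArg (x * ·) h.cacac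

lemma alt_mul_a (h : TriangleRels a b c) {k : W} (hk : Alt a c k) : Alt a c (k * a) := by
  cases hk
  · simpa using Alt.a
  · simpa [h.aa] using Alt.e
  · exact Alt.ca
  · exact Alt.aca
  · simpa [h.mul_aa] using Alt.c
  · simpa [h.mul_aa] using Alt.ac
  · exact Alt.caca
  · exact Alt.acaca
  · simpa [h.mul_aa] using Alt.cac
  · simpa [h.mul_aa] using Alt.acac

lemma alt_mul_c (h : TriangleRels a b c) {k : W} (hk : Alt a c k) : Alt a c (k * c) := by
  cases hk
  · simpa using Alt.c
  · exact Alt.ac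
  · simpa [h.cc] using Alt.e
  · simpa [h.mul_cc] using Alt.a
  · exact Alt.cac
  · exact Alt.acac
  · simpa [h.mul_cc] using Alt.ca
  · simpa [h.mul_cc] using Alt.aca
  · rw [h.cacac]; exact Alt.acaca
  · rw [← h.cacac, h.mul_cc]; exact Alt.caca

lemma reach_cases (h : TriangleRels a b c) {n : ℕ} {g : W} (hg : Reach a b c n g) :
    (n = 0 ∧ Alt a c g) ∨
      ∃ m x k, n = m + 1 ∧ Reach a b c m x ∧ Alt a c k ∧ g = x * b * k := by
  induction hg with
  | one => exact .inl ⟨rfl, Alt.e⟩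
  | mul_a _ ih =>
    rcases ih with ⟨h0, hk⟩ | ⟨m, x, k, hn, hx, hk, rfl⟩
    · exact .inl ⟨h0, h.alt_mul_a hk⟩
    · exact .inr ⟨m, x, k * a, hn, hx, h.alt_mul_a hk, by simp only [mul_assoc]⟩
  | mul_c _ ih =>
    rcases ih with ⟨h0, hk⟩ | ⟨m, x, k, hn, hx, hk, rfl⟩
    · exact .inl ⟨h0, h.alt_mul_c hk⟩
    · exact .inr ⟨m, x, k * c, hn, hx, h.alt_mul_c hk, by simp only [mul_assoc]⟩
  | @mul_b n g hx _ => exact .inr ⟨n, g, 1, rfl, hx, Alt.e, by simp⟩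

lemma exists_reach (h : TriangleRels a b c) (hgen : Subgroup.closure {a, b, c} = ⊤) (g : W) :
    ∃ n, Reach a b c n g := by
  have inv_eq {x : W} (hx : x * x = 1) : x⁻¹ = x := inv_eq_of_mul_eq_one_left hx
  have hg : g ∈ Subgroup.closure {a, b, c} := hgen ▸ Subgroup.mem_top g
  induction hg using Subgroup.closure_induction_right with
  | one => exact ⟨0, .one⟩
  | mul_right x _ y hy ih =>
    obtain ⟨n, hn⟩ := ih
    rcases hy with rfl | rfl | rfl
    exacts [⟨_, hn.mul_a⟩, ⟨_, hn.mul_b⟩, ⟨_, hn.mul_c⟩]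
  | mul_inv_cancel x _ y hy ih =>
    obtain ⟨n, hn⟩ := ih
    rcases hy with rfl | rfl | rfl
    · rw [inv_eq h.aa]; exact ⟨_, hn.mul_a⟩
    · rw [inv_eq h.bb]; exact ⟨_, hn.mul_b⟩
    · rw [inv_eq h.cc]; exact ⟨_, hn.mul_c⟩

lemma reach_level (h : TriangleRels a b c) (hgen : Subgroup.closure {a, b, c} = ⊤) (g : W) :
    Reach a b c (level a b c g) g :=
  Nat.sInf_mem (h.exists_reach hgen g)

lemma level_mul_a (h : TriangleRels a b c) (hgen : Subgroup.closure {a, b, c} = ⊤) (g : W) :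
    level a b c (g * a) = level a b c g := by
  refine le_antisymm (Nat.sInf_le (h.reach_level hgen g).mul_a) (Nat.sInf_le ?_)
  simpa [h.mul_aa] using (h.reach_level hgen (g * a)).mul_a

lemma level_mul_c (h : TriangleRels a b c) (hgen : Subgroup.closure {a, b, c} = ⊤) (g : W) :
    level a b c (g * c) = level a b c g := by
  refine le_antisymm (Nat.sInf_le (h.reach_level hgen g).mul_c) (Nat.sInf_le ?_)
  simpa [h.mul_cc] using (h.reach_level hgen (g * c)).mul_c

lemma level_mul_b_le (h : TriangleRels a b c) (hgen : Subgroup.closure {a, b, c} = ⊤) (g : W) :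
    level a b c (g * b) ≤ level a b c g + 1 :=
  Nat.sInf_le (h.reach_level hgen g).mul_b

lemma level_mul_ab_le (h : TriangleRels a b c) (hgen : Subgroup.closure {a, b, c} = ⊤) (g : W) :
    level a b c (g * a * b) ≤ level a b c (g * b) + 1 := by
  have := h.level_mul_b_le hgen (g * b * a)
  rwa [h.mul_bab, h.level_mul_a hgen, h.level_mul_a hgen] at this

lemma level_mul_cb_le (h : TriangleRels a b c) (hgen : Subgroup.closure {a, b, c} = ⊤) (g : W) :
    level a b c (g * c * b) ≤ level a b c (g * b) + 1 := by
  have := h.level_mul_b_le hgen (g * b * c)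
  rwa [h.mul_bcb, h.level_mul_c hgen, h.level_mul_c hgen] at this

end TriangleRels

/-- A function on a `(3, 3, 5)` triangle group, to be thought of as the distance of `g • p` to
`p`, where `p` is a vertex stabilised by `a` and `c`. -/
structure Spreading (a b c : W) (f : W → ℝ) : Prop where
  mul_a : ∀ g, f (g * a) = f g
  mul_c : ∀ g, f (g * c) = f g
  a_mul : ∀ g, f (a * g) = f g
  c_mul : ∀ g, f (c * g) = f g
  base : f 1 < f b
  edge : ∀ g, f g + f (g * b) < f (g * a * b) + f (g * c * b)
  acac : ∀ g, 2 * f g < f (g * b) + f (g * a * c * a * c * b)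
  acaca : ∀ g, 2 * f g < f (g * b) + f (g * a * c * a * c * a * b)

namespace Spreading

variable {f : W → ℝ}

/-- The induction hypothesis for `Spreading.lt_of_level_pos`: the function `f` increases from
`g * b` to `g`, with some control on the neighbours of `g * b`. -/
def Ascends (a b c : W) (f : W → ℝ) (g : W) : Prop :=
  f (g * b) < f g ∧
    ((f (g * b) ≤ f (g * a * b) ∧ f (g * b) ≤ f (g * c * b)) ∨
      (f (g * b) ≤ f (g * a * b) ∧ level a b c (g * c * b) ≤ level a b c (g * b)) ∨
      (f (g * b) ≤ f (g * c * b) ∧ level a b c (g * a * b) ≤ level a b c (g * b)))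

lemma base_alt (hf : Spreading a b c f) {k : W} (hk : Alt a c k) : f 1 < f (k * b) := by
  have := hf.base
  cases hk <;> simpa only [mul_assoc, one_mul, hf.a_mul, hf.c_mul]

lemma ascends_step (h : TriangleRels a b c) (hgen : Subgroup.closure {a, b, c} = ⊤)
    (hf : Spreading a b c f) {g k : W} (hk : Alt a c k) (hg : Ascends a b c f g)
    (h1 : level a b c (g * b) < level a b c g)
    (h2 : level a b c g < level a b c (g * k * b)) :
    Ascends a b c f (g * k * b) := by
  have ha := hf.mul_a
  have hc := hf.mul_c
  have e0 := hf.edge g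
  have e1 := hf.edge (g * a)
  have e2 := hf.edge (g * a * c)
  have e3 := hf.edge (g * a * c * a)
  have e4 := hf.edge (g * a * c * a * c)
  have e5 := hf.edge (g * a * c * a * c * a)
  have e6 := hf.edge (g * c)
  have e7 := hf.edge (g * c * a)
  have e8 := hf.edge (g * c * a * c)
  have e9 := hf.edge (g * c * a * c * a)
  have f1 := hf.acac g
  have f2 := hf.acac (g * c * a * c * a)
  have f3 := hf.acaca g
  have l1 := h.level_mul_ab_le hgen g
  have l2 := h.level_mul_cb_le hgen g
  have l3 := h.level_mul_ab_le hgen (g * c)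
  have l4 := h.level_mul_cb_le hgen (g * a)
  simp only [ha, hc, h.mul_aa, h.mul_cc, h.mul_cacac] at e0 e1 e2 e3 e4 e5 e6 e7 e8 e9 f1 f2 f3
  obtain ⟨g1, g2⟩ := hg
  cases hk
  case e => simp at h2; omega
  case a => omega
  case c => omega
  all_goals
    simp only [Ascends, ← mul_assoc, h.mul_bab, h.mul_bcb, h.mul_bb, ha, hc, h.mul_aa, h.mul_cc,
      h.mul_cacac, h.level_mul_a hgen, h.level_mul_c hgen] at h2 ⊢
    rcases g2 with ⟨g2, g3⟩ | ⟨g2, g3⟩ | ⟨g2, g3⟩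
    all_goals first
      | omega
      | exact ⟨by linarith, .inl ⟨by linarith, by linarith⟩⟩
      | exact ⟨by linarith, .inr (.inl ⟨by linarith, by omega⟩)⟩
      | exact ⟨by linarith, .inr (.inr ⟨by linarith, by omega⟩)⟩

lemma ascends (h : TriangleRels a b c) (hgen : Subgroup.closure {a, b, c} = ⊤)
    (hf : Spreading a b c f) (n : ℕ) (g : W) (h1 : level a b c g = n + 1)
    (h2 : level a b c (g * b) = n) : Ascends a b c f g := by
  induction n generalizing g with
  | zero =>
    rcases h.reach_cases (h.reach_level hgen (g * b)) with ⟨-, hk⟩ | ⟨m, x, k, hm, -⟩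
    · have hA := hf.base_alt (h.alt_mul_a hk)
      have hC := hf.base_alt (h.alt_mul_c hk)
      have hB := hf.base_alt hk
      have h0 := eq_of_alt hf.mul_a hf.mul_c 1 hk
      simp only [h.mul_bab, h.mul_bcb, h.mul_bb, hf.mul_a, hf.mul_c, one_mul] at hA hC hB h0
      exact ⟨by linarith, .inl ⟨by linarith, by linarith⟩⟩
    · omega
  | succ n ih =>
    rcases h.reach_cases (h.reach_level hgen (g * b)) with ⟨h0, -⟩ | ⟨m, x, k, hm, hx, hk, hgx⟩
    · omega
    · have hxm : level a b c x ≤ m := Nat.sInf_le hx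
      have h3 := h.level_mul_b_le hgen x
      have h4 := eq_of_alt (h.level_mul_a hgen) (h.level_mul_c hgen) (x * b) hk
      rw [← hgx] at h4
      have hg : g = x * b * k * b := by rw [← hgx, h.mul_bb]
      rw [hg]
      have h5 : level a b c (x * b * b) = level a b c x := by rw [h.mul_bb]
      exact ascends_step h hgen hf hk (ih _ (by omega) (by omega)) (by omega)
        (by rw [← hg]; omega)

lemma lt_of_level_pos (h : TriangleRels a b c) (hgen : Subgroup.closure {a, b, c} = ⊤)
    (hf : Spreading a b c f) (n : ℕ) (g : W) (hg : level a b c g = n + 1) : f 1 < f g := by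
  induction n generalizing g with
  | zero =>
    rcases h.reach_cases (h.reach_level hgen g) with ⟨h0, -⟩ | ⟨m, x, k, hm, hx, hk, rfl⟩
    · omega
    · rw [eq_of_alt hf.mul_a hf.mul_c _ hk]
      obtain rfl : m = 0 := by omega
      rcases h.reach_cases hx with ⟨-, hx⟩ | ⟨_, _, _, h0, -⟩
      · exact hf.base_alt hx
      · omega
  | succ n ih =>
    rcases h.reach_cases (h.reach_level hgen g) with ⟨h0, -⟩ | ⟨m, x, k, hm, hx, hk, rfl⟩
    · omega
    · have hxm : level a b c x ≤ m := Nat.sInf_le hx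
      have h3 := h.level_mul_b_le hgen x
      have h4 := eq_of_alt (h.level_mul_a hgen) (h.level_mul_c hgen) (x * b) hk
      rw [eq_of_alt hf.mul_a hf.mul_c _ hk]
      have h5 := (ascends h hgen hf (n + 1) (x * b) (by omega) (by rw [h.mul_bb]; omega)).1
      rw [h.mul_bb] at h5
      exact (ih x (by omega)).trans h5

/-- A spreading function is minimal only on the finite subgroup generated by `a` and `c`. -/
theorem alt_of_le (h : TriangleRels a b c) (hgen : Subgroup.closure {a, b, c} = ⊤)
    (hf : Spreading a b c f) {g : W} (hg : f g ≤ f 1) : Alt a c g := by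
  rcases h.reach_cases (h.reach_level hgen g) with ⟨-, hk⟩ | ⟨m, _, _, hm, -⟩
  · exact hk
  · exact absurd hg (lt_of_level_pos h hgen hf m g hm).not_ge

end Spreading

end Levels

section Hermitian

open Complex ComplexConjugate

/-- The golden ratio. -/
noncomputable def tau : ℝ := Real.goldenRatio

lemma tau_sq : tau ^ 2 = tau + 1 := Real.goldenRatio_sq

lemma alpha0_re : alpha0.re = (tau - 2) / 2 := by
  simp [alpha0, tau, Real.goldenRatio]
  ring

lemma alpha0_im_sq : alpha0.im ^ 2 = (7 * tau - 1) / 4 := by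
  have h5 : √5 ^ 2 = (5 : ℝ) := Real.sq_sqrt (by norm_num)
  have h2 : (2 : ℝ) ≤ √5 := Real.le_sqrt_of_sq_le (by norm_num)
  have hs : s0 ^ 2 = 4 * √5 - 5 := Real.sq_sqrt (by linarith)
  have him : alpha0.im = -((1 + √5) * s0 / 4) := by
    simp [alpha0]
    ring
  rw [him, tau, Real.goldenRatio]
  linear_combination (1 + √5) ^ 2 / 16 * hs + (4 * √5 + 3) / 16 * h5

/-- The Hermitian form preserved by the complex reflections `I1`, `I2`, `I3`. -/
noncomputable def hermForm : Matrix (Fin 3) (Fin 3) ℂ :=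
  !![2, -1, alpha0; -1, 2, -1; conj alpha0, -1, 2]

/-- A negative vector fixed up to sign by `I1` and `I3`. -/
noncomputable def basepoint : Fin 3 → ℂ :=
  ![(tau - 1) * (alpha0 - 2), 4 - 3 * tau, (tau - 1) * (conj alpha0 - 2)]

lemma alpha0_add_conj : alpha0 + conj alpha0 = tau - 2 := by
  rw [Complex.add_conj, alpha0_re]
  push_cast
  ring

lemma alpha0_mul_conj_s16 : alpha0 * conj alpha0 = tau + 1 := by
  rw [Complex.mul_conj, Complex.normSq_apply, alpha0_re, ← sq alpha0.im, alpha0_im_sq]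
  norm_cast
  linear_combination tau_sq / 4

lemma ofReal_tau_sq : (tau : ℂ) ^ 2 = tau + 1 := mod_cast tau_sq

lemma I1_mul_self : I1 * I1 = 1 := by
  ext i j; fin_cases i <;> fin_cases j <;> simp [I1, Matrix.mul_apply, Fin.sum_univ_three]

lemma I2_mul_self : I2 * I2 = 1 := by
  ext i j; fin_cases i <;> fin_cases j <;> simp [I2, Matrix.mul_apply, Fin.sum_univ_three]

lemma I3_mul_self : I3 * I3 = 1 := by
  ext i j; fin_cases i <;> fin_cases j <;> simp [I3, Matrix.mul_apply, Fin.sum_univ_three]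

lemma I2_mul_I1_mul_I2 : I2 * I1 * I2 = I1 * I2 * I1 := by
  ext i j; fin_cases i <;> fin_cases j <;> simp [I1, I2, Matrix.mul_apply, Fin.sum_univ_three, add_comm]

lemma I2_mul_I3_mul_I2 : I2 * I3 * I2 = I3 * I2 * I3 := by
  ext i j; fin_cases i <;> fin_cases j <;> simp [I2, I3, Matrix.mul_apply, Fin.sum_univ_three, add_comm]

lemma I3_mul_I1_braid : I3 * I1 * I3 * I1 * I3 = I1 * I3 * I1 * I3 * I1 := by
  have h1 := alpha0_add_conj
  have h2 := alpha0_mul_conj_s16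
  have h3 := ofReal_tau_sq
  ext i j
  fin_cases i <;> fin_cases j <;> simp [I1, I3, Matrix.mul_apply, Fin.sum_univ_three] <;> grind

lemma hermForm_mul_I1 : hermForm * I1 = I1ᴴ * hermForm := by
  ext i j
  fin_cases i <;> fin_cases j <;> simp [I1, hermForm, Matrix.mul_apply, Fin.sum_univ_three] <;> ring

lemma hermForm_mul_I2 : hermForm * I2 = I2ᴴ * hermForm := by
  ext i j
  fin_cases i <;> fin_cases j <;> simp [I2, hermForm, Matrix.mul_apply, Fin.sum_univ_three] <;> ring

lemma hermForm_mul_I3 : hermForm * I3 = I3ᴴ * hermForm := by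
  ext i j
  fin_cases i <;> fin_cases j <;> simp [I3, hermForm, Matrix.mul_apply, Fin.sum_univ_three] <;> ring

lemma hermForm_mulVec_basepoint : hermForm *ᵥ basepoint = ![0, 1, 0] := by
  have h1 := alpha0_add_conj
  have h2 := alpha0_mul_conj_s16
  have h3 := ofReal_tau_sq
  ext i
  fin_cases i <;> simp [hermForm, basepoint, Matrix.mulVec, dotProduct, Fin.sum_univ_three] <;> grind

lemma I1_mulVec_basepoint : I1 *ᵥ basepoint = -basepoint := by
  have h1 := alpha0_add_conj
  have h2 := alpha0_mul_conj_s16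
  have h3 := ofReal_tau_sq
  ext i
  fin_cases i <;> simp [I1, basepoint, Matrix.mulVec, dotProduct, Fin.sum_univ_three] <;> grind

lemma I3_mulVec_basepoint : I3 *ᵥ basepoint = -basepoint := by
  have h1 := alpha0_add_conj
  have h2 := alpha0_mul_conj_s16
  have h3 := ofReal_tau_sq
  ext i
  fin_cases i <;> simp [I3, basepoint, Matrix.mulVec, dotProduct, Fin.sum_univ_three] <;> grind

lemma hermForm_mulVec_I1 {v : Fin 3 → ℂ} {x y z : ℂ} (h : hermForm *ᵥ v = ![x, y, z]) :
    hermForm *ᵥ (I1 *ᵥ v) = ![x, -x - y, conj alpha0 * x - z] := by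
  rw [mulVec_mulVec, hermForm_mul_I1, ← mulVec_mulVec, h]
  ext i
  fin_cases i <;> simp [I1, Matrix.mulVec, dotProduct, Fin.sum_univ_three] <;> ring

lemma hermForm_mulVec_I2 {v : Fin 3 → ℂ} {x y z : ℂ} (h : hermForm *ᵥ v = ![x, y, z]) :
    hermForm *ᵥ (I2 *ᵥ v) = ![-x - y, y, -y - z] := by
  rw [mulVec_mulVec, hermForm_mul_I2, ← mulVec_mulVec, h]
  ext i
  fin_cases i <;> simp [I2, Matrix.mulVec, dotProduct, Fin.sum_univ_three] <;> ring

lemma hermForm_mulVec_I3 {v : Fin 3 → ℂ} {x y z : ℂ} (h : hermForm *ᵥ v = ![x, y, z]) :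
    hermForm *ᵥ (I3 *ᵥ v) = ![-x + alpha0 * z, -y - z, z] := by
  rw [mulVec_mulVec, hermForm_mul_I3, ← mulVec_mulVec, h]
  ext i
  fin_cases i <;> simp [I3, Matrix.mulVec, dotProduct, Fin.sum_univ_three] <;> ring


lemma one_lt_tau : 1 < tau := Real.one_lt_goldenRatio

lemma hermitian_nonneg {p r s : ℝ} {u v w : ℂ} (hp : 0 < p) (hA : 0 < p * r - normSq u)
    (hdet : 0 ≤ (p * r - normSq u) * (p * s - normSq v) - normSq (p * w - conj u * v))
    (x y z : ℂ) :
    0 ≤ p * normSq x + r * normSq y + s * normSq z +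
      2 * (u * conj x * y + v * conj x * z + w * conj y * z).re := by
  have key : (p * r - normSq u) * p * (p * normSq x + r * normSq y + s * normSq z +
      2 * (u * conj x * y + v * conj x * z + w * conj y * z).re) =
      (p * r - normSq u) * normSq (p * x + u * y + v * z) +
      normSq ((p * r - normSq u : ℝ) * y + (p * w - conj u * v) * z) +
      ((p * r - normSq u) * (p * s - normSq v) - normSq (p * w - conj u * v)) * normSq z := by
    simp only [normSq_apply, add_re, add_im, mul_re, mul_im, sub_re, sub_im, conj_re, conj_im,
      ofReal_re, ofReal_im]
    ring
  have h1 : 0 < (p * r - normSq u) * p := mul_pos hA hp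
  refine nonneg_of_mul_nonneg_right (a := (p * r - normSq u) * p) ?_ h1
  rw [key]
  have := normSq_nonneg (p * x + u * y + v * z)
  have := normSq_nonneg ((p * r - normSq u : ℝ) * y + (p * w - conj u * v) * z)
  have := normSq_nonneg z
  positivity

/-- The value of the Hermitian form on the vector with coordinates `x`, `y`, `z`. -/
noncomputable def hermQuad (x y z : ℂ) : ℝ :=
  2 * (normSq x + normSq y + normSq z) + 2 * (-conj x * y + alpha0 * conj x * z - conj y * z).re

lemma two_mul_normSq_lt {u₀ u₁ u₂ u v w : ℂ} {p r s : ℝ} (hu₀ : normSq u₀ = p - 3)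
    (hu₁ : normSq u₁ = r - 1) (hu₂ : normSq u₂ = s - 3) (hu : u₀ * conj u₁ = u + 2)
    (hv : u₀ * conj u₂ = v - 1 - alpha0) (hw : u₁ * conj u₂ = w + 2)
    (hp : 0 < p) (hA : 0 < p * r - normSq u)
    (hdet : 0 ≤ (p * r - normSq u) * (p * s - normSq v) - normSq (p * w - conj u * v))
    {x y z : ℂ} (h : hermQuad x y z < 0) :
    2 * normSq y <
      normSq (conj x - conj y + conj z) + normSq (conj x * u₀ + conj y * u₁ + conj z * u₂) := by
  have key := hermitian_nonneg hp hA hdet x y z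
  have h1 : normSq (conj x * u₀ + conj y * u₁ + conj z * u₂) =
      normSq u₀ * normSq x + normSq u₁ * normSq y + normSq u₂ * normSq z +
      2 * (u₀ * conj u₁ * conj x * y + u₀ * conj u₂ * conj x * z +
        u₁ * conj u₂ * conj y * z).re := by
    simp only [normSq_apply, add_re, add_im, mul_re, mul_im, conj_re, conj_im]
    ring
  have h2 : normSq (conj x - conj y + conj z) = normSq x + normSq y + normSq z +
      2 * (-conj x * y + conj x * z - conj y * z).re := by
    simp only [normSq_apply, add_re, add_im, mul_re, conj_re, conj_im, sub_re, sub_im, neg_re,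
      neg_im]
    ring
  rw [h1, h2, hu₀, hu₁, hu₂, hu, hv, hw]
  rw [hermQuad] at h
  simp only [add_re, sub_re, mul_re, mul_im, add_im, sub_im, conj_re, conj_im, neg_re, neg_im,
    one_re, one_im, re_ofNat, im_ofNat] at *
  linarith

lemma normSq_ofReal_add_mul_alpha0 (x y : ℝ) :
    normSq (x + y * alpha0) = x ^ 2 + x * y * (tau - 2) + y ^ 2 * (tau + 1) := by
  rw [normSq_apply]
  simp only [add_re, mul_re, ofReal_re, ofReal_im, add_im, mul_im, alpha0_re]
  linear_combination y ^ 2 * alpha0_im_sq + y ^ 2 / 4 * tau_sq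

lemma two_mul_normSq_lt_acac {x y z : ℂ} (h : hermQuad x y z < 0) :
    2 * normSq y < normSq (conj x - conj y + conj z) +
      normSq (conj x * ((tau : ℝ) + (1 - tau : ℝ) * alpha0) +
        conj y * ((-3 - tau : ℝ) + (tau - 1 : ℝ) * alpha0) +
        conj z * ((3 - 2 * tau : ℝ) + (1 - tau : ℝ) * alpha0)) := by
  have h1 := alpha0_add_conj
  have h2 := alpha0_mul_conj_s16
  have h3 := ofReal_tau_sq
  have ht := tau_sq
  have ht1 := one_lt_tau
  have hu : normSq ((-6 - 3 * tau : ℝ) + (-3 + 3 * tau : ℝ) * alpha0) = 18 + 72 * tau := by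
    rw [normSq_ofReal_add_mul_alpha0]; grind
  have hv : normSq ((2 : ℝ) + (7 - 3 * tau : ℝ) * alpha0) = -5 + 12 * tau := by
    rw [normSq_ofReal_add_mul_alpha0]; grind
  have hw : ((7 : ℝ) : ℂ) * ((-3 : ℝ) + (-3 : ℝ) * alpha0) -
      conj ((-6 - 3 * tau : ℝ) + (-3 + 3 * tau : ℝ) * alpha0) *
        ((2 : ℝ) + (7 - 3 * tau : ℝ) * alpha0) =
      (-18 + 6 * tau : ℝ) + (6 : ℝ) * alpha0 := by
    simp only [map_add, map_mul, conj_ofReal]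
    push_cast
    grind
  refine two_mul_normSq_lt (p := 7) (r := 5 + 12 * tau) (s := 4)
    (u := (-6 - 3 * tau : ℝ) + (-3 + 3 * tau : ℝ) * alpha0)
    (v := (2 : ℝ) + (7 - 3 * tau : ℝ) * alpha0)
    (w := (-3 : ℝ) + (-3 : ℝ) * alpha0) ?_ ?_ ?_ ?_ ?_ ?_ ?_ ?_ ?_ h
  · rw [normSq_ofReal_add_mul_alpha0]; grind
  · rw [normSq_ofReal_add_mul_alpha0]; grind
  · rw [normSq_ofReal_add_mul_alpha0]; grind
  · simp only [map_add, map_mul, conj_ofReal]; push_cast; grind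
  · simp only [map_add, map_mul, conj_ofReal]; push_cast; grind
  · simp only [map_add, map_mul, conj_ofReal]; push_cast; grind
  · norm_num
  · rw [hu]; nlinarith
  · rw [hu, hv, hw, normSq_ofReal_add_mul_alpha0]; nlinarith

lemma two_mul_normSq_lt_acaca {x y z : ℂ} (h : hermQuad x y z < 0) :
    2 * normSq y < normSq (conj x - conj y + conj z) +
      normSq (conj x * ((0 : ℝ) + (tau - 1 : ℝ) * alpha0) +
        conj y * ((3 * tau : ℝ) + (0 : ℝ) * alpha0) +
        conj z * ((3 - 2 * tau : ℝ) + (1 - tau : ℝ) * alpha0)) := by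
  have h1 := alpha0_add_conj
  have h2 := alpha0_mul_conj_s16
  have h3 := ofReal_tau_sq
  have ht := tau_sq
  have ht1 := one_lt_tau
  have hu : normSq ((-2 : ℝ) + (3 : ℝ) * alpha0) = 25 + 3 * tau := by
    rw [normSq_ofReal_add_mul_alpha0]; grind
  have hv : normSq ((0 : ℝ) + (-4 + 3 * tau : ℝ) * alpha0) = 10 - 5 * tau := by
    rw [normSq_ofReal_add_mul_alpha0]; grind
  have hw : ((4 : ℝ) : ℂ) * ((-2 : ℝ) + (3 : ℝ) * alpha0) -
      conj ((-2 : ℝ) + (3 : ℝ) * alpha0) * ((0 : ℝ) + (-4 + 3 * tau : ℝ) * alpha0) =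
      (-5 - 6 * tau : ℝ) + (4 + 6 * tau : ℝ) * alpha0 := by
    simp only [map_add, map_mul, conj_ofReal]
    push_cast
    grind
  refine two_mul_normSq_lt (p := 4) (r := 10 + 9 * tau) (s := 4)
    (u := (-2 : ℝ) + (3 : ℝ) * alpha0)
    (v := (0 : ℝ) + (-4 + 3 * tau : ℝ) * alpha0)
    (w := (-2 : ℝ) + (3 : ℝ) * alpha0) ?_ ?_ ?_ ?_ ?_ ?_ ?_ ?_ ?_ h
  · rw [normSq_ofReal_add_mul_alpha0]; grind
  · rw [normSq_ofReal_add_mul_alpha0]; grind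
  · rw [normSq_ofReal_add_mul_alpha0]; grind
  · simp only [map_add, map_mul, conj_ofReal]; push_cast; grind
  · simp only [map_add, map_mul, conj_ofReal]; push_cast; grind
  · simp only [map_add, map_mul, conj_ofReal]; push_cast; grind
  · norm_num
  · rw [hu]; nlinarith
  · rw [hu, hv, hw, normSq_ofReal_add_mul_alpha0]; nlinarith

lemma normSq_add_lt_edge {x y z : ℂ} (h : hermQuad x y z < 0) :
    normSq y + normSq (conj x - conj y + conj z) <
      normSq (conj x - conj z * (1 - conj alpha0)) +
        normSq (conj x * (1 - alpha0) - conj z) := by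
  have h1 := alpha0_re
  have h2 := alpha0_im_sq
  have ht := tau_sq
  have key : normSq (conj x - conj z * (1 - conj alpha0)) +
      normSq (conj x * (1 - alpha0) - conj z) - normSq y - normSq (conj x - conj y + conj z) +
      hermQuad x y z = 3 / 2 * normSq (2 * conj x - (1 - conj alpha0) * conj z) := by
    simp only [hermQuad, normSq_apply, add_re, add_im, mul_re, mul_im, conj_re, conj_im, sub_re,
      sub_im, neg_re, neg_im, one_re, one_im, re_ofNat, im_ofNat, h1]
    grind
  have := normSq_nonneg (2 * conj x - (1 - conj alpha0) * conj z)
  linarith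

/-- The sesquilinear form with matrix `hermForm`. -/
noncomputable def hermPair (u v : Fin 3 → ℂ) : ℂ := star u ⬝ᵥ (hermForm *ᵥ v)

lemma hermPair_of_eq {u v : Fin 3 → ℂ} {x y z : ℂ} (h : hermForm *ᵥ v = ![x, y, z]) :
    hermPair u v = conj (u 0) * x + conj (u 1) * y + conj (u 2) * z := by
  rw [hermPair, h]
  simp [dotProduct, Fin.sum_univ_three]

lemma hermPair_self_re (u : Fin 3 → ℂ) : (hermPair u u).re = hermQuad (u 0) (u 1) (u 2) := by
  simp [hermPair, hermQuad, hermForm, mulVec, dotProduct, Fin.sum_univ_three, normSq_apply]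
  ring

lemma hermPair_basepoint_self : hermPair basepoint basepoint = (4 - 3 * tau : ℝ) := by
  rw [hermPair_of_eq hermForm_mulVec_basepoint]
  simp [basepoint, Complex.conj_ofNat]

lemma hermPair_mulVec_mulVec {A : Matrix (Fin 3) (Fin 3) ℂ} (hA : Aᴴ * hermForm * A = hermForm)
    (u v : Fin 3 → ℂ) : hermPair (A *ᵥ u) (A *ᵥ v) = hermPair u v := by
  rw [hermPair, hermPair, star_mulVec, ← dotProduct_mulVec, mulVec_mulVec, mulVec_mulVec, hA]

lemma isometry_mul {A B : Matrix (Fin 3) (Fin 3) ℂ} (hA : Aᴴ * hermForm * A = hermForm)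
    (hB : Bᴴ * hermForm * B = hermForm) : (A * B)ᴴ * hermForm * (A * B) = hermForm := by
  calc (A * B)ᴴ * hermForm * (A * B) = Bᴴ * (Aᴴ * hermForm * A) * B := by
        simp only [conjTranspose_mul, mul_assoc]
    _ = hermForm := by rw [hA, hB]

lemma isometry_I1 : I1ᴴ * hermForm * I1 = hermForm := by
  rw [← hermForm_mul_I1, mul_assoc, I1_mul_self, mul_one]

lemma isometry_I2 : I2ᴴ * hermForm * I2 = hermForm := by
  rw [← hermForm_mul_I2, mul_assoc, I2_mul_self, mul_one]

lemma isometry_I3 : I3ᴴ * hermForm * I3 = hermForm := by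
  rw [← hermForm_mul_I3, mul_assoc, I3_mul_self, mul_one]

/-- The invertible matrix `I1`. -/
noncomputable def glI1 : GL (Fin 3) ℂ := ⟨I1, I1, I1_mul_self, I1_mul_self⟩

/-- The invertible matrix `I2`. -/
noncomputable def glI2 : GL (Fin 3) ℂ := ⟨I2, I2, I2_mul_self, I2_mul_self⟩

/-- The invertible matrix `I3`. -/
noncomputable def glI3 : GL (Fin 3) ℂ := ⟨I3, I3, I3_mul_self, I3_mul_self⟩

lemma triangleRels_gl : TriangleRels glI1 glI2 glI3 where
  aa := Units.ext I1_mul_self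
  bb := Units.ext I2_mul_self
  cc := Units.ext I3_mul_self
  bab := Units.ext I2_mul_I1_mul_I2
  bcb := Units.ext I2_mul_I3_mul_I2
  cacac := Units.ext I3_mul_I1_braid

/-- The relators of the `(3, 3, 5)` triangle group. -/
def triangleRelators : Set (FreeGroup (Fin 3)) :=
  let a := FreeGroup.of 0
  let b := FreeGroup.of 1
  let c := FreeGroup.of 2
  {a * a, b * b, c * c, b * a * b * (a * b * a)⁻¹, b * c * b * (c * b * c)⁻¹,
    c * a * c * a * c * (a * c * a * c * a)⁻¹}

/-- The abstract `(3, 3, 5)` triangle group. -/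
abbrev TriangleGroup := PresentedGroup triangleRelators

lemma TriangleRels.lift_eq_one {G : Type*} [Group G] {f : Fin 3 → G}
    (h : TriangleRels (f 0) (f 1) (f 2)) : ∀ r ∈ triangleRelators, FreeGroup.lift f r = 1 := by
  rintro r (rfl | rfl | rfl | rfl | rfl | rfl) <;>
    simp only [map_mul, map_inv, FreeGroup.lift_apply_of, mul_inv_eq_one]
  exacts [h.aa, h.bb, h.cc, h.bab, h.bcb, h.cacac]

namespace TriangleGroup

/-- The first generating reflection. -/
def a : TriangleGroup := PresentedGroup.of 0

/-- The second generating reflection. -/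
def b : TriangleGroup := PresentedGroup.of 1

/-- The third generating reflection. -/
def c : TriangleGroup := PresentedGroup.of 2

lemma triangleRels : TriangleRels a b c := by
  constructor
  case bab | bcb | cacac =>
    refine mul_inv_eq_one.1 (PresentedGroup.one_of_mem (rels := triangleRelators) ?_)
    simp [triangleRelators]
  all_goals
    refine PresentedGroup.one_of_mem (rels := triangleRelators) ?_
    simp [triangleRelators]

lemma closure_eq_top : Subgroup.closure {a, b, c} = ⊤ := by
  rw [← PresentedGroup.closure_range_of]
  congr 1
  ext x
  simp [Fin.exists_fin_succ, a, b, c, eq_comm]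

/-- The representation of the triangle group by complex reflections. -/
noncomputable def rep : TriangleGroup →* GL (Fin 3) ℂ :=
  PresentedGroup.toGroup (f := ![glI1, glI2, glI3]) triangleRels_gl.lift_eq_one

lemma rep_a : (rep a : Matrix (Fin 3) (Fin 3) ℂ) = I1 := by
  simp [rep, a, glI1]

lemma rep_b : (rep b : Matrix (Fin 3) (Fin 3) ℂ) = I2 := by
  simp [rep, b, glI2]

lemma rep_c : (rep c : Matrix (Fin 3) (Fin 3) ℂ) = I3 := by
  simp [rep, c, glI3]

lemma rep_isometry (w : TriangleGroup) :
    (rep w : Matrix (Fin 3) (Fin 3) ℂ)ᴴ * hermForm * (rep w : Matrix (Fin 3) (Fin 3) ℂ) =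
      hermForm := by
  obtain ⟨n, hn⟩ := triangleRels.exists_reach closure_eq_top w
  induction hn with
  | one => simp
  | mul_a _ ih => rw [map_mul, Units.val_mul, rep_a]; exact isometry_mul ih isometry_I1
  | mul_b _ ih => rw [map_mul, Units.val_mul, rep_b]; exact isometry_mul ih isometry_I2
  | mul_c _ ih => rw [map_mul, Units.val_mul, rep_c]; exact isometry_mul ih isometry_I3

lemma hermPair_rep (w : TriangleGroup) (u v : Fin 3 → ℂ) :
    hermPair u ((rep w : Matrix (Fin 3) (Fin 3) ℂ) *ᵥ v) =
      hermPair ((rep w⁻¹ : Matrix (Fin 3) (Fin 3) ℂ) *ᵥ u) v := by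
  rw [← hermPair_mulVec_mulVec (rep_isometry w⁻¹), mulVec_mulVec, ← Units.val_mul, ← map_mul]
  simp

/-- The squared modulus of the pairing of the base point with its translate. -/
noncomputable def spread (w : TriangleGroup) : ℝ :=
  normSq (hermPair basepoint ((rep w : Matrix (Fin 3) (Fin 3) ℂ) *ᵥ basepoint))

lemma hermForm_mulVec_b : hermForm *ᵥ (I2 *ᵥ basepoint) = ![-1, 1, -1] := by
  simpa using hermForm_mulVec_I2 hermForm_mulVec_basepoint

lemma hermForm_mulVec_ab :
    hermForm *ᵥ (I1 *ᵥ (I2 *ᵥ basepoint)) = ![-1, 0, 1 - conj alpha0] := by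
  rw [hermForm_mulVec_I1 hermForm_mulVec_b]
  exact vec3_eq (by ring) (by ring) (by ring)

lemma hermForm_mulVec_cb :
    hermForm *ᵥ (I3 *ᵥ (I2 *ᵥ basepoint)) = ![1 - alpha0, 0, -1] := by
  rw [hermForm_mulVec_I3 hermForm_mulVec_b]
  exact vec3_eq (by ring) (by ring) (by ring)

lemma hermForm_mulVec_acacb :
    hermForm *ᵥ (I1 *ᵥ (I3 *ᵥ (I1 *ᵥ (I3 *ᵥ (I2 *ᵥ basepoint))))) =
      ![(tau : ℝ) + (1 - tau : ℝ) * alpha0, (-3 - tau : ℝ) + (tau - 1 : ℝ) * alpha0,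
        (3 - 2 * tau : ℝ) + (1 - tau : ℝ) * alpha0] := by
  have h1 := alpha0_add_conj
  have h2 := alpha0_mul_conj_s16
  have h3 := ofReal_tau_sq
  rw [hermForm_mulVec_I1 (hermForm_mulVec_I3 (hermForm_mulVec_I1 hermForm_mulVec_cb))]
  push_cast
  exact vec3_eq (by grind) (by grind) (by grind)

lemma hermForm_mulVec_acacab :
    hermForm *ᵥ (I1 *ᵥ (I3 *ᵥ (I1 *ᵥ (I3 *ᵥ (I1 *ᵥ (I2 *ᵥ basepoint)))))) =
      ![(0 : ℝ) + (tau - 1 : ℝ) * alpha0, (3 * tau : ℝ) + (0 : ℝ) * alpha0,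
        (3 - 2 * tau : ℝ) + (1 - tau : ℝ) * alpha0] := by
  have h1 := alpha0_add_conj
  have h2 := alpha0_mul_conj_s16
  have h3 := ofReal_tau_sq
  rw [hermForm_mulVec_I1 (hermForm_mulVec_I3 (hermForm_mulVec_I1
    (hermForm_mulVec_I3 hermForm_mulVec_ab)))]
  push_cast
  exact vec3_eq (by grind) (by grind) (by grind)

lemma hermQuad_rep_basepoint (w : TriangleGroup) {v : Fin 3 → ℂ}
    (hv : v = (rep w : Matrix (Fin 3) (Fin 3) ℂ) *ᵥ basepoint) :
    hermQuad (v 0) (v 1) (v 2) < 0 := by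
  rw [← hermPair_self_re, hv, hermPair_mulVec_mulVec (rep_isometry w), hermPair_basepoint_self,
    ofReal_re]
  nlinarith [tau_sq, one_lt_tau]

lemma spread_mul (w k : TriangleGroup) : spread (w * k) =
    normSq (hermPair ((rep w⁻¹ : Matrix (Fin 3) (Fin 3) ℂ) *ᵥ basepoint)
      ((rep k : Matrix (Fin 3) (Fin 3) ℂ) *ᵥ basepoint)) := by
  rw [spread, map_mul, Units.val_mul, ← mulVec_mulVec, hermPair_rep]

lemma spreading : Spreading a b c spread where
  mul_a w := by
    simp [spread, ← mulVec_mulVec, rep_a, I1_mulVec_basepoint, mulVec_neg, hermPair]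
  mul_c w := by
    simp [spread, ← mulVec_mulVec, rep_c, I3_mulVec_basepoint, mulVec_neg, hermPair]
  a_mul w := by
    rw [spread_mul, inv_eq_of_mul_eq_one_left triangleRels.aa, rep_a, I1_mulVec_basepoint]
    simp [spread, hermPair]
  c_mul w := by
    rw [spread_mul, inv_eq_of_mul_eq_one_left triangleRels.cc, rep_c, I3_mulVec_basepoint]
    simp [spread, hermPair]
  base := by
    have h1 := alpha0_add_conj
    have h3 := ofReal_tau_sq
    have hb : hermPair basepoint (I2 *ᵥ basepoint) = (3 * tau - 3 : ℝ) := by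
      rw [hermPair_of_eq hermForm_mulVec_b]
      simp [basepoint, Complex.conj_ofNat]
      grind
    rw [spread, spread, rep_b, hb, map_one, Units.val_one, one_mulVec, hermPair_basepoint_self,
      normSq_ofReal, normSq_ofReal]
    nlinarith [tau_sq, one_lt_tau]
  edge w := by
    have h := normSq_add_lt_edge (hermQuad_rep_basepoint w⁻¹ rfl)
    rw [← normSq_conj, ← normSq_neg (_ - _ + _), ← normSq_neg (_ - _ * _)] at h
    nth_rw 1 [← mul_one w]
    simp only [mul_assoc w, spread_mul, map_mul, map_one, Units.val_mul, Units.val_one,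
      one_mulVec, ← mulVec_mulVec, rep_a, rep_b, rep_c, hermPair_of_eq hermForm_mulVec_basepoint,
      hermPair_of_eq hermForm_mulVec_b, hermPair_of_eq hermForm_mulVec_ab,
      hermPair_of_eq hermForm_mulVec_cb]
    convert h using 3 <;> ring
  acac w := by
    have h := two_mul_normSq_lt_acac (hermQuad_rep_basepoint w⁻¹ rfl)
    rw [← normSq_conj, ← normSq_neg (_ - _ + _)] at h
    nth_rw 1 [← mul_one w]
    simp only [mul_assoc w, spread_mul, map_mul, map_one, Units.val_mul, Units.val_one,
      one_mulVec, ← mulVec_mulVec, rep_a, rep_b, rep_c, hermPair_of_eq hermForm_mulVec_basepoint,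
      hermPair_of_eq hermForm_mulVec_b, hermPair_of_eq hermForm_mulVec_acacb]
    convert h using 3 <;> ring_nf
  acaca w := by
    have h := two_mul_normSq_lt_acaca (hermQuad_rep_basepoint w⁻¹ rfl)
    rw [← normSq_conj, ← normSq_neg (_ - _ + _)] at h
    nth_rw 1 [← mul_one w]
    simp only [mul_assoc w, spread_mul, map_mul, map_one, Units.val_mul, Units.val_one,
      one_mulVec, ← mulVec_mulVec, rep_a, rep_b, rep_c, hermPair_of_eq hermForm_mulVec_basepoint,
      hermPair_of_eq hermForm_mulVec_b, hermPair_of_eq hermForm_mulVec_acacab]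
    convert h using 3 <;> ring_nf

lemma alpha0_ne_zero : alpha0 ≠ 0 := by
  intro h
  have h1 := alpha0_re
  have h2 := one_lt_tau
  have h3 := tau_sq
  rw [h, zero_re] at h1
  nlinarith

lemma alpha0_mul_conj_ne_two : alpha0 * conj alpha0 ≠ 2 := by
  rw [alpha0_mul_conj_s16]
  norm_cast
  linarith [one_lt_tau]

lemma eq_one_of_alt_of_scalar {k : TriangleGroup} (hk : Alt a c k) {z : ℂ}
    (hz : (rep k : Matrix (Fin 3) (Fin 3) ℂ) = scalar (Fin 3) z) : k = 1 := by
  have e01 := congrFun₂ hz 0 1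
  have e21 := congrFun₂ hz 2 1
  have e20 := congrFun₂ hz 2 0
  have e02 := congrFun₂ hz 0 2
  have h0 := alpha0_ne_zero
  have h0' : conj alpha0 ≠ 0 := (map_ne_zero _).2 h0
  have h2 := sub_ne_zero.2 alpha0_mul_conj_ne_two
  cases hk
  case e => rfl
  all_goals
    simp [rep_a, rep_c, I1, I3, Matrix.mul_apply, Fin.sum_univ_three] at e01 e21 e20 e02
  case aca => exact absurd e20 h0
  case cac => exact absurd e02 h0
  case caca => exact absurd (by linear_combination e20) (mul_ne_zero h0' h2)
  all_goals exact absurd (by linear_combination -e20) (mul_ne_zero h0' h2)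

end TriangleGroup
end Hermitian

section Embedding

lemma mul_inv_pow_eq_one {G : Type*} [Group G] {x y : G} {n : ℕ} (h : (x * y) ^ n = 1) :
    (x⁻¹ * y⁻¹) ^ n = 1 := by
  have : x⁻¹ * y⁻¹ = x⁻¹ * (x * y)⁻¹ * x⁻¹⁻¹ := by group
  rw [this, conj_pow, inv_pow, h, inv_one, mul_one, mul_inv_cancel]

lemma triangleRels_of_pow {G : Type*} [Group G] {a b c : G} (ha : a * a = 1) (hb : b * b = 1)
    (hc : c * c = 1) (hab : (a * b) ^ 3 = 1) (hbc : (b * c) ^ 3 = 1) (hac : (a * c) ^ 5 = 1) :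
    TriangleRels a b c := by
  have ha' := inv_eq_of_mul_eq_one_left ha
  have hb' := inv_eq_of_mul_eq_one_left hb
  have hc' := inv_eq_of_mul_eq_one_left hc
  refine ⟨ha, hb, hc, ?_, ?_, ?_⟩
  · rw [eq_comm, ← mul_inv_eq_one]
    simpa [pow_succ, mul_assoc, ha', hb'] using hab
  · rw [← mul_inv_eq_one]
    simpa [pow_succ, mul_assoc, hc', hb'] using hbc
  · rw [eq_comm, ← mul_inv_eq_one]
    simpa [pow_succ, mul_assoc, ha', hc'] using hac

lemma TriangleRels.pow_eq_one {G : Type*} [Group G] {a b c : G} (h : TriangleRels a b c) :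
    (a * b) ^ 3 = 1 ∧ (b * c) ^ 3 = 1 ∧ (a * c) ^ 5 = 1 := by
  have ha := inv_eq_of_mul_eq_one_left h.aa
  have hb := inv_eq_of_mul_eq_one_left h.bb
  have hc := inv_eq_of_mul_eq_one_left h.cc
  have h1 := mul_inv_eq_one.2 h.bab.symm
  have h2 := mul_inv_eq_one.2 h.bcb
  have h3 := mul_inv_eq_one.2 h.cacac.symm
  simp only [_root_.mul_inv_rev, ha, hb, hc, ← mul_assoc] at h1 h2 h3
  simp only [pow_succ, pow_zero, one_mul, ← mul_assoc]
  exact ⟨h1, h2, h3⟩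

lemma D_of_pow : (PresentedGroup.of 0 : D) ^ 3 = 1 ∧ (PresentedGroup.of 1 : D) ^ 3 = 1 ∧
    ((PresentedGroup.of 0 : D) * PresentedGroup.of 1) ^ 5 = 1 := by
  refine ⟨?_, ?_, ?_⟩ <;>
  · refine PresentedGroup.one_of_mem (rels := vonDyckRels) ?_
    simp [vonDyckRels]

lemma lift_vonDyckRels {G : Type*} [Group G] {f : Fin 2 → G} (h0 : f 0 ^ 3 = 1)
    (h1 : f 1 ^ 3 = 1) (h01 : (f 0 * f 1) ^ 5 = 1) :
    ∀ r ∈ vonDyckRels, FreeGroup.lift f r = 1 := by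
  rintro r (rfl | rfl | rfl) <;> simpa

/-- The automorphism of `D` that inverts both generators. -/
def inversion : D →* D :=
  PresentedGroup.toGroup (f := ![(PresentedGroup.of 0)⁻¹, (PresentedGroup.of 1)⁻¹])
    (lift_vonDyckRels (by simp [D_of_pow.1]) (by simp [D_of_pow.2.1])
      (mul_inv_pow_eq_one D_of_pow.2.2))

lemma inversion_of (i : Fin 2) : inversion (PresentedGroup.of i) = (PresentedGroup.of i)⁻¹ := by
  fin_cases i <;> simp [inversion]

lemma inversion_inversion (d : D) : inversion (inversion d) = d := by
  suffices inversion.comp inversion = MonoidHom.id D from DFunLike.congr_fun this d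
  ext i
  simp [inversion_of]

/-- The permutation of `D` underlying `inversion`. -/
def inversionPerm : Equiv.Perm D :=
  ⟨inversion, inversion, inversion_inversion, inversion_inversion⟩

lemma inversionPerm_mul_self : inversionPerm * inversionPerm = 1 :=
  Equiv.ext inversion_inversion

lemma toPermHom_mul_inversionPerm (i : Fin 2) :
    MulAction.toPermHom D D (PresentedGroup.of i) * inversionPerm =
      inversionPerm * (MulAction.toPermHom D D (PresentedGroup.of i))⁻¹ := by
  ext d
  rw [← map_inv]
  simp [inversionPerm, inversion_of]

lemma triangleRels_perm :
    TriangleRels (MulAction.toPermHom D D (PresentedGroup.of 0) * inversionPerm) inversionPerm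
      (inversionPerm * MulAction.toPermHom D D (PresentedGroup.of 1)) := by
  have h := inversionPerm_mul_self
  have hp := D_of_pow
  refine triangleRels_of_pow ?_ h ?_ ?_ ?_ ?_
  · nth_rw 1 [toPermHom_mul_inversionPerm]
    rw [mul_assoc, inv_mul_cancel_left, h]
  · rw [mul_assoc, ← mul_assoc _ inversionPerm, toPermHom_mul_inversionPerm,
      mul_assoc, inv_mul_cancel, mul_one, h]
  · rw [mul_assoc, h, mul_one, ← map_pow, hp.1, map_one]
  · rw [← mul_assoc, h, one_mul, ← map_pow, hp.2.1, map_one]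
  · rw [mul_assoc, ← mul_assoc inversionPerm, h, one_mul, ← map_mul, ← map_pow, hp.2.2, map_one]

namespace TriangleGroup

/-- The inclusion of the von Dyck group as the subgroup of even words. -/
def ofVonDyck : D →* TriangleGroup :=
  PresentedGroup.toGroup (f := ![a * b, b * c])
    (lift_vonDyckRels triangleRels.pow_eq_one.1 triangleRels.pow_eq_one.2.1 (by
      have hb := triangleRels.bb
      simpa [mul_assoc, ← mul_assoc b b, hb] using triangleRels.pow_eq_one.2.2))

lemma ofVonDyck_of_zero : ofVonDyck (PresentedGroup.of 0) = a * b := by simp [ofVonDyck]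

lemma ofVonDyck_of_one : ofVonDyck (PresentedGroup.of 1) = b * c := by simp [ofVonDyck]

/-- The action of the triangle group on the von Dyck group extending left translation. -/
def permHom : TriangleGroup →* Equiv.Perm D :=
  PresentedGroup.toGroup
    (f := ![MulAction.toPermHom D D (PresentedGroup.of 0) * inversionPerm, inversionPerm,
      inversionPerm * MulAction.toPermHom D D (PresentedGroup.of 1)])
    triangleRels_perm.lift_eq_one

lemma permHom_comp_ofVonDyck : permHom.comp ofVonDyck = MulAction.toPermHom D D := by
  have h := inversionPerm_mul_self
  ext i : 1
  fin_cases i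
  · simp [ofVonDyck_of_zero, permHom, a, b, mul_assoc, h]
  · simp [ofVonDyck_of_one, permHom, b, c, ← mul_assoc, h]

lemma ofVonDyck_injective : Function.Injective ofVonDyck := by
  have h : Function.Injective (permHom.comp ofVonDyck) := by
    rw [permHom_comp_ofVonDyck]
    exact MulAction.toPerm_injective
  exact Function.Injective.of_comp h

lemma eq_one_of_rep_mem_center {w : TriangleGroup}
    (hw : rep w ∈ Subgroup.center (GL (Fin 3) ℂ)) : w = 1 := by
  obtain ⟨z, hz⟩ := GeneralLinearGroup.mem_center_iff_val_mem_range_scalar.1 hw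
  have hv : (rep w : Matrix (Fin 3) (Fin 3) ℂ) *ᵥ basepoint = z • basepoint := by
    rw [← hz]; simp
  have hp : hermPair basepoint (z • basepoint) = z * hermPair basepoint basepoint := by
    simp [hermPair, mulVec_smul]
  have hne : hermPair basepoint basepoint ≠ 0 := by
    rw [hermPair_basepoint_self, Complex.ofReal_ne_zero]
    nlinarith [tau_sq, one_lt_tau]
  have hn : Complex.normSq z = 1 := by
    have h := hermPair_mulVec_mulVec (rep_isometry w) basepoint basepoint
    have hs : hermPair (z • basepoint) (z • basepoint) =
        Complex.normSq z * hermPair basepoint basepoint := by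
      rw [Complex.normSq_eq_conj_mul_self]
      simp [hermPair, mulVec_smul, mul_assoc, mul_left_comm]
    rw [hv, hs, mul_eq_right₀ hne] at h
    exact_mod_cast h
  refine eq_one_of_alt_of_scalar (spreading.alt_of_le triangleRels closure_eq_top ?_) hz.symm
  simp [spread, hv, hp, hn]

end TriangleGroup

end Embedding

theorem presentation_of_triangle_group
    (g1 g2 : GL (Fin 3) ℂ)
    (h1 : (g1 : Matrix (Fin 3) (Fin 3) ℂ) = I1 * I2)
    (h2 : (g2 : Matrix (Fin 3) (Fin 3) ℂ) = I2 * I3) :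
    ∃ ρ : D →* GL (Fin 3) ℂ ⧸ Subgroup.center (GL (Fin 3) ℂ),
      Function.Injective ρ ∧
      ρ (PresentedGroup.of 0) = QuotientGroup.mk g1 ∧
      ρ (PresentedGroup.of 1) = QuotientGroup.mk g2 := by
  refine ⟨(QuotientGroup.mk' _).comp (TriangleGroup.rep.comp TriangleGroup.ofVonDyck),
    (injective_iff_map_eq_one _).2 fun d hd => ?_, ?_, ?_⟩
  · refine (injective_iff_map_eq_one _).1 TriangleGroup.ofVonDyck_injective d ?_
    exact TriangleGroup.eq_one_of_rep_mem_center ((QuotientGroup.eq_one_iff _).1 hd)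
  · refine congrArg QuotientGroup.mk (Units.ext ?_)
    simp [TriangleGroup.ofVonDyck_of_zero, TriangleGroup.rep_a, TriangleGroup.rep_b, h1]
  · refine congrArg QuotientGroup.mk (Units.ext ?_)
    simp [TriangleGroup.ofVonDyck_of_one, TriangleGroup.rep_b, TriangleGroup.rep_c, h2]
end

section
/- Let P : GL(3,ℂ) → GL(3,ℂ)/Z denote the quotient by the center, and let Γ̄ be the subgroup of GL(3,ℂ)/Z generated by P(I₁I₂) and P(I₂I₃). Then every element of finite order in Γ̄ is conjugate within Γ̄ to a power of P(I₁I₂), a power of P(I₂I₃), or a power of P(I₃I₁). (That is, the only elliptic elements of the even-length subgroup of the (3,3,5;∞)-triangle group are conjugates of powers of I₁I₂, I₂I₃, and I₃I₁.) -/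
open Matrix

/-- Projection of `GL(3,ℂ)` onto its quotient by the center. -/
noncomputable def P : GL (Fin 3) ℂ →* GL (Fin 3) ℂ ⧸ Subgroup.center (GL (Fin 3) ℂ) :=
  QuotientGroup.mk' (Subgroup.center (GL (Fin 3) ℂ))

namespace TriangleGroup

open DihedralGroup

section Dihedral

variable {G : Type*} [Group G]

/-- The homomorphism from the dihedral group of order `10` determined by an involution `a` and an
element `c` of order dividing `5` inverted by `a`. -/
def dihedralHom (a c : G) (ha : a * a = 1) (hc : c ^ 5 = 1) (hac : a * c * a = c⁻¹) :
    DihedralGroup 5 →* G :=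
  have key : ∀ n : ℕ, c ^ n = c ^ (n % 5) := fun n => by
    conv_lhs => rw [← Nat.div_add_mod n 5, pow_add, pow_mul, hc, one_pow, one_mul]
  have hadd : ∀ i j : ZMod 5, c ^ (i + j).val = c ^ i.val * c ^ j.val := fun i j => by
    rw [ZMod.val_add, ← key, pow_add]
  have hsub : ∀ i j : ZMod 5, c ^ (j - i).val = (c ^ i.val)⁻¹ * c ^ j.val := fun i j => by
    rw [eq_inv_mul_iff_mul_eq, ← hadd, add_sub_cancel]
  have ha' : a⁻¹ = a := inv_eq_of_mul_eq_one_left ha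
  have hconj : ∀ n : ℕ, c ^ n * a = a * (c ^ n)⁻¹ := fun n => by
    have h : (a * c * a⁻¹) ^ n = (c⁻¹) ^ n := by rw [ha', hac]
    rw [conj_pow, inv_pow] at h
    rw [← h, ha']
    simp only [← mul_assoc, ha, one_mul]
  { toFun := fun s => match s with
      | r i => c ^ i.val
      | sr i => a * c ^ i.val
    map_one' := by simp only [one_def, ZMod.val_zero, pow_zero]
    map_mul' := by
      rintro (i | i) (j | j)
      · simp only [r_mul_r, hadd]
      · simp only [r_mul_sr, hsub, ← mul_assoc, hconj]
      · simp only [sr_mul_r, hadd, mul_assoc]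
      · simp only [sr_mul_sr, hsub]
        rw [← mul_assoc, mul_assoc a, hconj, ← mul_assoc, ha, one_mul] }

end Dihedral

section Words

variable {G : Type*} [Group G] (φ : DihedralGroup 5 →* G) (b : G)

/-- The product of the `n` factors `φ (f i) * b`, `φ (f (i + 1)) * b`, …. -/
def word (f : ℕ → DihedralGroup 5) : ℕ → ℕ → G
  | _, 0 => 1
  | i, n + 1 => φ (f i) * b * word f (i + 1) n

@[simp] lemma word_zero (f : ℕ → DihedralGroup 5) (i : ℕ) : word φ b f i 0 = 1 := rfl

lemma word_succ (f : ℕ → DihedralGroup 5) (i n : ℕ) :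
    word φ b f i (n + 1) = φ (f i) * b * word φ b f (i + 1) n := rfl

lemma word_one (f : ℕ → DihedralGroup 5) (i : ℕ) : word φ b f i 1 = φ (f i) * b := by
  simp [word_succ]

lemma word_add (f : ℕ → DihedralGroup 5) (i m n : ℕ) :
    word φ b f i (m + n) = word φ b f i m * word φ b f (i + m) n := by
  induction m generalizing i with
  | zero => simp
  | succ m ih =>
    rw [show m + 1 + n = (m + n) + 1 by ring, word_succ, word_succ, ih,
      show i + 1 + m = i + (m + 1) by ring]
    simp only [mul_assoc]

lemma word_congr {f g : ℕ → DihedralGroup 5} {i k n : ℕ}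
    (h : ∀ j < n, f (i + j) = g (k + j)) : word φ b f i n = word φ b g k n := by
  induction n generalizing i k with
  | zero => rfl
  | succ n ih =>
    rw [word_succ, word_succ, ih (i := i + 1) (k := k + 1), show f i = g k from h 0 (by omega)]
    intro j hj
    rw [add_assoc, add_assoc, add_comm 1 j]
    exact h (j + 1) (by omega)

lemma word_const {f : ℕ → DihedralGroup 5} {s : DihedralGroup 5} {i n : ℕ}
    (h : ∀ j < n, f (i + j) = s) : word φ b f i n = (φ s * b) ^ n := by
  induction n generalizing i with
  | zero => simp
  | succ n ih =>
    rw [word_succ, pow_succ', ih (i := i + 1), show f i = s from h 0 (by omega)]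
    intro j hj
    rw [add_assoc, add_comm 1 j]
    exact h (j + 1) (by omega)

lemma word_mul_of_periodic {f : ℕ → DihedralGroup 5} {d : ℕ} (hf : ∀ i, f (i + d) = f i)
    (n : ℕ) : word φ b f 0 (d * n) = word φ b f 0 d ^ n := by
  have hshift : ∀ k j, f (d * k + j) = f j := by
    intro k
    induction k with
    | zero => simp
    | succ k ih => intro j; rw [← ih j, ← hf (d * k + j)]; congr 1; ring
  induction n with
  | zero => simp
  | succ n ih =>
    rw [mul_add, mul_one, word_add, ih, pow_succ,
      word_congr φ b (i := 0 + d * n) (k := 0) (g := f) (n := d)]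
    intro j _
    simp [hshift]

/-- `g` is a product of elements of the image of `φ` and exactly `n` factors `b`. -/
def HasLength (n : ℕ) (g : G) : Prop :=
  ∃ f : ℕ → DihedralGroup 5, ∃ s, g = word φ b f 0 n * φ s

variable {φ b}

lemma hasLength_map (s : DihedralGroup 5) : HasLength φ b 0 (φ s) :=
  ⟨fun _ => 1, s, by simp⟩

lemma HasLength.mul_right {n : ℕ} {g : G} (h : HasLength φ b n g) (t : DihedralGroup 5) :
    HasLength φ b n (g * φ t) := by
  obtain ⟨f, s, rfl⟩ := h
  exact ⟨f, s * t, by rw [map_mul, mul_assoc]⟩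

/-- Prepend a letter to a sequence. -/
def cons (s : DihedralGroup 5) (f : ℕ → DihedralGroup 5) : ℕ → DihedralGroup 5
  | 0 => s
  | n + 1 => f n

lemma word_cons (s : DihedralGroup 5) (f : ℕ → DihedralGroup 5) (n : ℕ) :
    word φ b (cons s f) 0 (n + 1) = φ s * b * word φ b f 0 n := by
  rw [word_succ, word_congr φ b (g := f) (k := 0)]
  · rfl
  · intro j _
    rw [zero_add, add_comm, zero_add]
    rfl

lemma exists_word_eq_map_mul_word (s : DihedralGroup 5) (f : ℕ → DihedralGroup 5) {n : ℕ}
    (hn : n ≠ 0) : ∃ f', word φ b f' 0 n = φ s * word φ b f 0 n := by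
  obtain ⟨n, rfl⟩ := Nat.exists_eq_succ_of_ne_zero hn
  refine ⟨cons (s * f 0) fun i => f (i + 1), ?_⟩
  rw [Nat.succ_eq_add_one, word_cons, word_succ, map_mul,
    word_congr φ b (g := f) (k := 0 + 1) (i := 0) (n := n)]
  · simp only [mul_assoc]
  · intro j _
    congr 1
    ring

lemma HasLength.mul_left {n : ℕ} {g : G} (h : HasLength φ b n g) (t : DihedralGroup 5) :
    HasLength φ b n (φ t * g) := by
  obtain ⟨f, s, rfl⟩ := h
  rcases eq_or_ne n 0 with rfl | hn
  · exact ⟨f, t * s, by simp⟩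
  · obtain ⟨f', hf'⟩ := exists_word_eq_map_mul_word (φ := φ) (b := b) t f hn
    exact ⟨f', s, by rw [hf', mul_assoc]⟩

lemma HasLength.b_mul {n : ℕ} {g : G} (h : HasLength φ b n g) :
    HasLength φ b (n + 1) (b * g) := by
  obtain ⟨f, s, rfl⟩ := h
  exact ⟨cons 1 f, s, by rw [word_cons, map_one, one_mul, mul_assoc]⟩

lemma hasLength_word (f : ℕ → DihedralGroup 5) (i n : ℕ) :
    HasLength φ b n (word φ b f i n) := by
  induction n generalizing i with
  | zero => simpa using hasLength_map (φ := φ) (b := b) 1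
  | succ n ih =>
    rw [word_succ, mul_assoc]
    exact (ih (i + 1)).b_mul.mul_left _

lemma HasLength.mul {m n : ℕ} {g h : G} (hg : HasLength φ b m g) (hh : HasLength φ b n h) :
    HasLength φ b (m + n) (g * h) := by
  obtain ⟨f, s, rfl⟩ := hg
  rw [mul_assoc]
  replace hh := hh.mul_left s
  generalize φ s * h = h at hh
  clear s
  have : ∀ i, HasLength φ b (m + n) (word φ b f i m * h) := by
    induction m with
    | zero => simpa using hh
    | succ m ih =>
      intro i
      rw [word_succ, mul_assoc, mul_assoc, show m + 1 + n = m + n + 1 by ring]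
      exact (ih (i + 1)).b_mul.mul_left _
  exact this 0

lemma hasLength_b : HasLength φ b 1 b := by
  simpa using (hasLength_map (φ := φ) (b := b) 1).b_mul

lemma HasLength.inv (hb : b * b = 1) {n : ℕ} {g : G} (hg : HasLength φ b n g) :
    HasLength φ b n g⁻¹ := by
  obtain ⟨f, s, rfl⟩ := hg
  rw [_root_.mul_inv_rev, ← map_inv]
  refine HasLength.mul_left ?_ _
  have : ∀ i, HasLength φ b n (word φ b f i n)⁻¹ := by
    induction n with
    | zero => simpa using hasLength_map (φ := φ) (b := b) 1
    | succ n ih =>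
      intro i
      rw [word_succ, _root_.mul_inv_rev, _root_.mul_inv_rev, inv_eq_of_mul_eq_one_left hb, ← map_inv]
      exact (ih (i + 1)).mul (hasLength_b.mul_right _)
  exact this 0

lemma exists_hasLength (hb : b * b = 1) {g : G}
    (hg : g ∈ Subgroup.closure (Set.range φ ∪ {b})) : ∃ n, HasLength φ b n g := by
  induction hg using Subgroup.closure_induction with
  | mem x hx =>
    rcases hx with ⟨s, rfl⟩ | rfl
    · exact ⟨0, hasLength_map s⟩
    · exact ⟨1, hasLength_b⟩
  | one => exact ⟨0, by simpa using hasLength_map (φ := φ) (b := b) 1⟩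
  | mul x y _ _ hx hy =>
    obtain ⟨m, hm⟩ := hx
    obtain ⟨n, hn⟩ := hy
    exact ⟨m + n, hm.mul hn⟩
  | inv x _ hx =>
    obtain ⟨n, hn⟩ := hx
    exact ⟨n, hn.inv hb⟩

/-- A sequence of letters containing no subword that can be shortened: in the tessellation by
decagons it describes a path that is a local geodesic. -/
structure Reduced (f : ℕ → DihedralGroup 5) : Prop where
  ne_one : ∀ i, f i ≠ 1
  ne_sr_zero : ∀ i, f i ≠ sr 0
  ne_sr_four : ∀ i, f i ≠ sr 4
  ne_r_one : ∀ i m, f i = r 4 → (∀ j < m, f (i + 1 + j) = sr 3) → f (i + 1 + m) ≠ r 1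
  ne_r_four : ∀ i m, f i = r 1 → (∀ j < m, f (i + 1 + j) = sr 1) → f (i + 1 + m) ≠ r 4

lemma rewrite_left {a c x : G} (hab : a * b * a = b * a * b)
    (hcb : c * b * c = b * c * b) (m : ℕ) (hx : x = b * (a * c * b) * (c * a * c * b) ^ m * c) :
    x * (a * b) = a * b * (a * c * a * b) ^ (m + 1) * a := by
  have key : ∀ m : ℕ, b * (a * c * b) * (c * a * c * b) ^ m * c =
      a * b * (a * c * a * b) ^ m * (a * c * b) := by
    intro m
    induction m with
    | zero =>
      calc b * (a * c * b) * (c * a * c * b) ^ 0 * c = b * a * (c * b * c) := by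
            simp only [pow_zero, mul_one, mul_assoc]
        _ = (b * a * b) * c * b := by rw [hcb]; simp only [mul_assoc]
        _ = _ := by rw [← hab]; simp only [pow_zero, mul_one, mul_assoc]
    | succ m ih =>
      calc b * (a * c * b) * (c * a * c * b) ^ (m + 1) * c
          = (b * (a * c * b) * (c * a * c * b) ^ m * c) * (a * (c * b * c)) := by
            simp only [pow_succ, mul_assoc]
        _ = a * b * (a * c * a * b) ^ m * (a * c) * (b * a * b) * c * b := by
            rw [ih, hcb]; simp only [mul_assoc]
        _ = _ := by rw [← hab]; simp only [pow_succ, mul_assoc]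
  rw [hx, key]
  calc a * b * (a * c * a * b) ^ m * (a * c * b) * (a * b)
      = a * b * (a * c * a * b) ^ m * (a * c) * (b * a * b) := by simp only [mul_assoc]
    _ = _ := by rw [← hab]; simp only [pow_succ, mul_assoc]

lemma word_mem (f : ℕ → DihedralGroup 5) (i n : ℕ) :
    word φ b f i n ∈ Subgroup.closure (Set.range φ ∪ {b}) := by
  induction n generalizing i with
  | zero => exact one_mem _
  | succ n ih =>
    refine mul_mem (mul_mem ?_ ?_) (ih (i + 1))
    · exact Subgroup.subset_closure (Or.inl ⟨_, rfl⟩)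
    · exact Subgroup.subset_closure (Or.inr rfl)

lemma word_pattern (f : ℕ → DihedralGroup 5) {s t u : DihedralGroup 5} {i m : ℕ}
    (h0 : f i = s) (h1 : ∀ j < m, f (i + 1 + j) = t) (h2 : f (i + 1 + m) = u) :
    word φ b f i (m + 2) = φ s * b * (φ t * b) ^ m * (φ u * b) := by
  rw [show m + 2 = (m + 1) + 1 by ring, word_succ, word_add, word_one, h0, h2,
    word_const φ b h1]
  simp only [mul_assoc]

/-- The subword `8 3 ⋯ 3 2` can be shortened. -/
lemma hasLength_pattern_left (h0 : φ (sr 0) * b * φ (sr 0) = b * φ (sr 0) * b)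
    (h4 : φ (sr 4) * b * φ (sr 4) = b * φ (sr 4) * b) (m : ℕ) :
    HasLength φ b (m + 2)
      (b * (φ (r 4) * b * (φ (sr 3) * b) ^ m * (φ (r 1) * b))) := by
  have e8 : φ (r 4) = φ (sr 0) * φ (sr 4) := by rw [← map_mul]; rfl
  have e3 : φ (sr 3) = φ (sr 4) * φ (sr 0) * φ (sr 4) := by rw [← map_mul, ← map_mul]; rfl
  have e2 : φ (r 1) = φ (sr 4) * φ (sr 0) := by rw [← map_mul]; rfl
  have e7 : φ (sr 0) * φ (sr 4) * φ (sr 0) = φ (sr 1) := by rw [← map_mul, ← map_mul]; rfl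
  have h := rewrite_left h0 h4 m rfl
  rw [e7, ← e8, ← e3] at h
  have e : b * (φ (r 4) * b * (φ (sr 3) * b) ^ m * (φ (r 1) * b)) =
      φ (sr 0) * (b * (φ (sr 1) * b) ^ (m + 1) * φ (sr 0)) := by
    rw [e2]
    simpa only [mul_assoc] using h
  rw [e, ← word_const φ b (f := fun _ => sr 1) (i := 0) (fun _ _ => rfl), mul_assoc]
  exact ((hasLength_word _ _ _).mul_right _).b_mul.mul_left _

/-- The subword `2 7 ⋯ 7 8` can be shortened. -/
lemma hasLength_pattern_right (h0 : φ (sr 0) * b * φ (sr 0) = b * φ (sr 0) * b)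
    (h4 : φ (sr 4) * b * φ (sr 4) = b * φ (sr 4) * b) (m : ℕ) :
    HasLength φ b (m + 2)
      (b * (φ (r 1) * b * (φ (sr 1) * b) ^ m * (φ (r 4) * b))) := by
  have e8 : φ (r 1) = φ (sr 4) * φ (sr 0) := by rw [← map_mul]; rfl
  have e3 : φ (sr 1) = φ (sr 0) * φ (sr 4) * φ (sr 0) := by rw [← map_mul, ← map_mul]; rfl
  have e2 : φ (r 4) = φ (sr 0) * φ (sr 4) := by rw [← map_mul]; rfl
  have e7 : φ (sr 4) * φ (sr 0) * φ (sr 4) = φ (sr 3) := by rw [← map_mul, ← map_mul]; rfl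
  have h := rewrite_left h4 h0 m rfl
  rw [e7, ← e8, ← e3] at h
  have e : b * (φ (r 1) * b * (φ (sr 1) * b) ^ m * (φ (r 4) * b)) =
      φ (sr 4) * (b * (φ (sr 3) * b) ^ (m + 1) * φ (sr 4)) := by
    rw [e2]
    simpa only [mul_assoc] using h
  rw [e, ← word_const φ b (f := fun _ => sr 3) (i := 0) (fun _ _ => rfl), mul_assoc]
  exact ((hasLength_word _ _ _).mul_right _).b_mul.mul_left _

/-- `φ (r 4) * b * φ (r 1) * b` is conjugate to a rotation. -/
lemma conj_eight_two (hb : b * b = 1) (h0 : φ (sr 0) * b * φ (sr 0) = b * φ (sr 0) * b)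
    (h4 : φ (sr 4) * b * φ (sr 4) = b * φ (sr 4) * b) :
    (b * φ (sr 0)) * (φ (r 4) * b * (φ (r 1) * b)) * (b * φ (sr 0))⁻¹ = φ (r 1) := by
  have e8 : φ (r 4) = φ (sr 0) * φ (sr 4) := by rw [← map_mul]; rfl
  have e2 : φ (r 1) = φ (sr 4) * φ (sr 0) := by rw [← map_mul]; rfl
  have ha : φ (sr 0) * φ (sr 0) = 1 := by rw [← map_mul, ← map_one φ]; rfl
  rw [mul_inv_eq_iff_eq_mul, e8, e2]
  generalize φ (sr 0) = a at *
  generalize φ (sr 4) = c at *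
  calc b * a * (a * c * b * (c * a * b)) = b * (a * a) * (c * b * c) * a * b := by
        simp only [mul_assoc]
    _ = (b * b) * c * (b * a * b) := by rw [ha, h4]; simp only [mul_assoc, mul_one]
    _ = _ := by rw [hb, ← h0]; simp only [mul_assoc, one_mul]

/-- Every element of the group generated by the image of `φ` and `b` is conjugate to an element
of the image of `φ`, to one of three short words, or to a cyclically reduced word. -/
theorem exists_conj_reduced (hb : b * b = 1)
    (h0 : φ (sr 0) * b * φ (sr 0) = b * φ (sr 0) * b)
    (h4 : φ (sr 4) * b * φ (sr 4) = b * φ (sr 4) * b) {g : G}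
    (hg : g ∈ Subgroup.closure (Set.range φ ∪ {b})) :
    ∃ h ∈ Subgroup.closure (Set.range φ ∪ {b}),
      (∃ s, h * g * h⁻¹ = φ s) ∨ h * g * h⁻¹ = b ∨ h * g * h⁻¹ = φ (sr 0) * b ∨
      h * g * h⁻¹ = φ (sr 4) * b ∨
      ∃ f d, 0 < d ∧ (∀ i, f (i + d) = f i) ∧ Reduced f ∧ h * g * h⁻¹ = word φ b f 0 d := by
  classical
  set Γ := Subgroup.closure (Set.range φ ∪ {b}) with hΓ
  have hφΓ : ∀ s, φ s ∈ Γ := fun s => Subgroup.subset_closure (Or.inl ⟨s, rfl⟩)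
  have hbΓ : b ∈ Γ := Subgroup.subset_closure (Or.inr rfl)
  have hex : ∃ n, ∃ h ∈ Γ, HasLength φ b n (h * g * h⁻¹) := by
    obtain ⟨n, hn⟩ := exists_hasLength hb hg
    exact ⟨n, 1, one_mem _, by simpa using hn⟩
  obtain ⟨n, ⟨h, hh, f₀, s, hfs⟩, hmin⟩ :
      ∃ n, (∃ h ∈ Γ, HasLength φ b n (h * g * h⁻¹)) ∧
        ∀ m < n, ∀ k ∈ Γ, ¬ HasLength φ b m (k * g * k⁻¹) :=
    ⟨Nat.find hex, Nat.find_spec hex, fun m hm k hk hl => Nat.find_min hex hm ⟨k, hk, hl⟩⟩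
  rcases Nat.eq_zero_or_pos n with rfl | hn
  · exact ⟨h, hh, Or.inl ⟨s, by simpa using hfs⟩⟩
  obtain ⟨f₁, hf₁⟩ := exists_word_eq_map_mul_word (φ := φ) (b := b) s f₀ hn.ne'
  obtain ⟨f, hper, hf⟩ : ∃ f : ℕ → DihedralGroup 5, (∀ i, f (i + n) = f i) ∧
      word φ b f 0 n = φ s * word φ b f₀ 0 n := by
    refine ⟨fun i => f₁ (i % n), fun i => by simp, ?_⟩
    rw [← hf₁]
    refine word_congr φ b fun j hj => ?_
    simp [Nat.mod_eq_of_lt hj]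
  replace hfs : (φ s * h) * g * (φ s * h)⁻¹ = word φ b f 0 n := by
    rw [hf]
    calc (φ s * h) * g * (φ s * h)⁻¹ = φ s * (h * g * h⁻¹) * (φ s)⁻¹ := by group
      _ = _ := by rw [hfs]; group
  replace hh : φ s * h ∈ Γ := mul_mem (hφΓ s) hh
  generalize φ s * h = h at hfs hh
  have hrot : ∀ i, ∃ k ∈ Γ, k * g * k⁻¹ = word φ b f i n := fun i => by
    refine ⟨(word φ b f 0 i)⁻¹ * h, mul_mem (inv_mem (word_mem f 0 i)) hh, ?_⟩
    have e : word φ b f 0 i * word φ b f i n = word φ b f 0 n * word φ b f 0 i := by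
      have e₁ := word_add φ b f 0 i n
      rw [add_comm i n, word_add, zero_add, zero_add,
        word_congr φ b (f := f) (g := f) (i := n) (k := 0) (n := i)] at e₁
      · exact e₁.symm
      · intro j _
        rw [zero_add, add_comm, hper]
    calc (word φ b f 0 i)⁻¹ * h * g * ((word φ b f 0 i)⁻¹ * h)⁻¹
        = (word φ b f 0 i)⁻¹ * (h * g * h⁻¹) * word φ b f 0 i := by group
      _ = _ := by rw [hfs, mul_assoc, ← e, inv_mul_cancel_left]
  have hmin' : ∀ i, ∀ m < n, ∀ k ∈ Γ, ¬ HasLength φ b m (k * word φ b f i n * k⁻¹) := by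
    intro i m hm k hk hl
    obtain ⟨k', hk', e⟩ := hrot i
    refine hmin m hm (k * k') (mul_mem hk hk') ?_
    rw [← e] at hl
    convert hl using 1
    group
  have hshort : ∀ i m k, m + 1 ≤ n → k ≤ m → ¬ HasLength φ b k (b * word φ b f i m) := by
    intro i m k hmn hkm hl
    obtain ⟨p, rfl⟩ := Nat.exists_eq_add_of_le hmn
    refine hmin' i (0 + k + p) (by omega) (φ (f (i + (m + p))) * b)
      (mul_mem (hφΓ _) hbΓ) ?_
    rw [show m + 1 + p = m + p + 1 by ring, word_add, word_one, word_add]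
    have : φ (f (i + (m + p))) * b *
        (word φ b f i m * word φ b f (i + m) p * (φ (f (i + (m + p))) * b)) *
        (φ (f (i + (m + p))) * b)⁻¹ =
        φ (f (i + (m + p))) * (b * word φ b f i m) * word φ b f (i + m) p := by group
    rw [this]
    exact ((hasLength_map _).mul hl).mul (hasLength_word _ _ _)
  by_cases hred : Reduced f
  · exact ⟨h, hh, Or.inr (Or.inr (Or.inr (Or.inr ⟨f, n, hn, hper, hred, hfs⟩)))⟩
  have hne : ∀ s t : DihedralGroup 5, s ≠ t → ∀ i, f i = s → f (i + n) ≠ t := by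
    intro s t hst i hi
    rw [hper, hi]
    exact hst
  have hpat : ∀ (s t u : DihedralGroup 5) (i m : ℕ), s ≠ t → s ≠ u → f i = s →
      (∀ j < m, f (i + 1 + j) = t) → f (i + 1 + m) = u → m + 2 ≤ n := by
    intro s t u i m hst hsu hi hj hm
    by_contra! hlt
    have e : i + n = i + 1 + (n - 1) := by omega
    rcases (show n - 1 ≤ m by omega).lt_or_eq with h' | h'
    · exact hne s t hst i hi (e ▸ hj _ h')
    · exact hne s u hsu i hi (by rw [e, h', hm])
  have hleft : ∀ i m, m + 3 ≤ n → f i = r 4 → (∀ j < m, f (i + 1 + j) = sr 3) →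
      f (i + 1 + m) ≠ r 1 := by
    intro i m hmn hi hj hm
    refine hshort i (m + 2) (m + 2) (by omega) le_rfl ?_
    rw [word_pattern f hi hj hm]
    exact hasLength_pattern_left h0 h4 m
  have hright : ∀ i m, m + 3 ≤ n → f i = r 1 → (∀ j < m, f (i + 1 + j) = sr 1) →
      f (i + 1 + m) ≠ r 4 := by
    intro i m hmn hi hj hm
    refine hshort i (m + 2) (m + 2) (by omega) le_rfl ?_
    rw [word_pattern f hi hj hm]
    exact hasLength_pattern_right h0 h4 m
  have htwo : n = 2 → ∀ i, f i = r 4 → f (i + 1) ≠ r 1 := by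
    rintro rfl i hi hi'
    refine hmin' i 0 (by norm_num) (b * φ (sr 0)) (mul_mem hbΓ (hφΓ _)) ?_
    rw [word_pattern (m := 0) f hi (t := 1) (by simp) hi', pow_zero, mul_one,
      conj_eight_two hb h0 h4]
    exact hasLength_map _
  rcases (show n = 1 ∨ 2 ≤ n by omega) with rfl | hn2
  · have hconst : ∀ i, f i = f 0 := fun i => by
      induction i with
      | zero => rfl
      | succ i ih => rw [hper, ih]
    rw [word_one] at hfs
    have : f 0 = 1 ∨ f 0 = sr 0 ∨ f 0 = sr 4 := by
      by_contra! hcon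
      refine hred ⟨fun i => ?_, fun i => ?_, fun i => ?_, fun i m hi _ hm => ?_,
        fun i m hi _ hm => ?_⟩
      · rw [hconst]; exact hcon.1
      · rw [hconst]; exact hcon.2.1
      · rw [hconst]; exact hcon.2.2
      · rw [hconst] at hi hm; rw [hi] at hm; revert hm; decide
      · rw [hconst] at hi hm; rw [hi] at hm; revert hm; decide
    refine ⟨h, hh, Or.inr ?_⟩
    rcases this with e | e | e <;> rw [e] at hfs
    · exact Or.inl (by rw [hfs, map_one, one_mul])
    · exact Or.inr (Or.inl hfs)
    · exact Or.inr (Or.inr (Or.inl hfs))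
  · refine absurd ⟨fun i hi => ?_, fun i hi => ?_, fun i hi => ?_, fun i m hi hj hm => ?_,
      fun i m hi hj hm => ?_⟩ hred
    · refine hshort i 1 0 hn2 (by norm_num) ?_
      rw [word_one, hi, map_one, one_mul, hb, ← map_one φ]
      exact hasLength_map _
    · refine hshort i 1 1 hn2 le_rfl ?_
      rw [word_one, hi, ← mul_assoc, ← h0, mul_assoc]
      exact (hasLength_map _).b_mul.mul_left _
    · refine hshort i 1 1 hn2 le_rfl ?_
      rw [word_one, hi, ← mul_assoc, ← h4, mul_assoc]
      exact (hasLength_map _).b_mul.mul_left _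
    · have hle := hpat _ _ _ i m (by decide) (by decide) hi hj hm
      rcases hle.lt_or_eq with hlt | rfl
      · exact hleft i m hlt hi hj hm
      · rcases Nat.eq_zero_or_pos m with rfl | hm0
        · exact htwo rfl i hi hm
        · refine hright (i + 1 + m) 0 (by omega) hm (by simp) ?_
          rw [show i + 1 + m + 1 + 0 = i + (m + 2) by ring, hper, hi]
    · have hle := hpat _ _ _ i m (by decide) (by decide) hi hj hm
      rcases hle.lt_or_eq with hlt | rfl
      · exact hright i m hlt hi hj hm
      · rcases Nat.eq_zero_or_pos m with rfl | hm0
        · refine htwo rfl (i + 1) hm ?_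
          rw [show i + 1 + 1 = i + (0 + 2) by ring, hper, hi]
        · refine hleft (i + 1 + m) 0 (by omega) hm (by simp) ?_
          rw [show i + 1 + m + 1 + 0 = i + (m + 2) by ring, hper, hi]

end Words
end TriangleGroup

namespace TriangleGroup

open ComplexConjugate DihedralGroup

/-- The linear functional with coefficients `u`, `v`, `w`. -/
def functional (u v w : ℂ) (z : Fin 3 → ℂ) : ℂ := u * z 0 + v * z 1 + w * z 2

/-- The Hermitian form preserved by the triangle group. -/
noncomputable def form (α : ℂ) (z : Fin 3 → ℂ) : ℝ :=
  2 * Complex.normSq (z 0) + 2 * Complex.normSq (z 1) + 2 * Complex.normSq (z 2) +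
    2 * (α * conj (z 0) * z 2 - conj (z 0) * z 1 - conj (z 1) * z 2).re

section SumsOfSquares

variable {p : ℝ} {α : ℂ} (hp : p ^ 2 = p + 1) (hc : conj α = p - 2 - α)
  (hα : α ^ 2 = (p - 2) * α - (p + 1)) (z : Fin 3 → ℂ)
include hp hc hα

lemma sum_sq_r_four :
    Complex.normSq (functional (2 + α) (1 - α) (-1 + α) z) +
      Complex.normSq (functional 1 (-1) 1 z) - Complex.normSq (functional (p - 3 - α) 0 1 z) -
      Complex.normSq (z 1) + form α z =
    6 * Complex.normSq (functional (1 / 2 - p / 2 + α / 2) 1 (-1) z) := by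
  apply Complex.ofReal_injective
  replace hp : (p : ℂ) ^ 2 = p + 1 := by exact_mod_cast congrArg Complex.ofReal hp
  simp only [form, functional, Complex.ofReal_add, Complex.ofReal_sub, Complex.ofReal_mul,
    ← Complex.mul_conj, Complex.re_eq_add_conj, map_add, map_sub, map_mul, map_neg, map_div₀,
    map_one, map_zero, map_ofNat, Complex.conj_conj, Complex.conj_ofReal, hc,
    Complex.ofReal_ofNat]
  generalize z 0 = x, z 1 = y, z 2 = w, conj (z 0) = x', conj (z 1) = y', conj (z 2) = w'
  grind

lemma sum_sq_r_one :
    Complex.normSq (functional (p - 3 - α) (3 - p + α) (p - α) z) +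
      Complex.normSq (functional 1 (-1) 1 z) - Complex.normSq (functional 1 0 (-1 + α) z) -
      Complex.normSq (z 1) + form α z =
    6 * Complex.normSq (functional 1 (-1) (1 / 2 + α / 2) z) := by
  apply Complex.ofReal_injective
  replace hp : (p : ℂ) ^ 2 = p + 1 := by exact_mod_cast congrArg Complex.ofReal hp
  simp only [form, functional, Complex.ofReal_add, Complex.ofReal_sub, Complex.ofReal_mul,
    ← Complex.mul_conj, Complex.re_eq_add_conj, map_add, map_sub, map_mul, map_neg, map_div₀,
    map_one, map_zero, map_ofNat, Complex.conj_conj, Complex.conj_ofReal, hc,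
    Complex.ofReal_ofNat]
  generalize z 0 = x, z 1 = y, z 2 = w, conj (z 0) = x', conj (z 1) = y', conj (z 2) = w'
  grind

lemma sum_sq_sr_three :
    Complex.normSq (functional (3 - 3 * p + (1 - p) * α) (-3) (p - α) z) +
      Complex.normSq (functional 1 (-1) 1 z) - 2 * Complex.normSq (z 1) + 2 * form α z =
    9 * Complex.normSq
        (functional 1 (-1 / 3 + p / 3 + (1 / 3 - p / 3) * α) (p / 3 * α) z) +
      (4 + 4 * p) * Complex.normSq (functional 0 1 (-1 / 2 + (1 - p / 2) * α) z) := by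
  apply Complex.ofReal_injective
  replace hp : (p : ℂ) ^ 2 = p + 1 := by exact_mod_cast congrArg Complex.ofReal hp
  simp only [form, functional, Complex.ofReal_add, Complex.ofReal_sub, Complex.ofReal_mul,
    ← Complex.mul_conj, Complex.re_eq_add_conj, map_add, map_sub, map_mul, map_neg, map_div₀,
    map_one, map_zero, map_ofNat, Complex.conj_conj, Complex.conj_ofReal, hc,
    Complex.ofReal_ofNat]
  generalize z 0 = x, z 1 = y, z 2 = w, conj (z 0) = x', conj (z 1) = y', conj (z 2) = w'
  grind

lemma sum_sq_sr_one :
    Complex.normSq (functional (2 + α) (-3) (-p + (p - 1) * α) z) +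
      Complex.normSq (functional 1 (-1) 1 z) - 2 * Complex.normSq (z 1) + 2 * form α z =
    12 * Complex.normSq
        (functional (-3 / 4 - α / 4) 1 (-1 / 4 + p / 4 + (1 / 4 - p / 4) * α) z) +
      3 * Complex.normSq (functional 1 0 α z) := by
  apply Complex.ofReal_injective
  replace hp : (p : ℂ) ^ 2 = p + 1 := by exact_mod_cast congrArg Complex.ofReal hp
  simp only [form, functional, Complex.ofReal_add, Complex.ofReal_sub, Complex.ofReal_mul,
    ← Complex.mul_conj, Complex.re_eq_add_conj, map_add, map_sub, map_mul, map_neg, map_div₀,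
    map_one, map_zero, map_ofNat, Complex.conj_conj, Complex.conj_ofReal, hc,
    Complex.ofReal_ofNat]
  generalize z 0 = x, z 1 = y, z 2 = w, conj (z 0) = x', conj (z 1) = y', conj (z 2) = w'
  grind

lemma sum_sq_sr_two :
    Complex.normSq (functional (-3 + 2 * p + (p - 1) * α) (-3 * p) ((1 - p) * α) z) +
      Complex.normSq (functional 1 (-1) 1 z) - 2 * Complex.normSq (z 1) + 2 * form α z =
    6 * Complex.normSq (functional 1 (-1 / 2 + α / 2) ((-1 / 2 + p / 2) * α) z) +
      (6 + 9 * p) * Complex.normSq (functional 0 1 (-7 / 2 + 2 * p + (1 - p / 2) * α) z) +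
      (6 * p - 9) * Complex.normSq (z 2) := by
  apply Complex.ofReal_injective
  replace hp : (p : ℂ) ^ 2 = p + 1 := by exact_mod_cast congrArg Complex.ofReal hp
  simp only [form, functional, Complex.ofReal_add, Complex.ofReal_sub, Complex.ofReal_mul,
    ← Complex.mul_conj, Complex.re_eq_add_conj, map_add, map_sub, map_mul, map_neg, map_div₀,
    map_one, map_zero, map_ofNat, Complex.conj_conj, Complex.conj_ofReal, hc,
    Complex.ofReal_ofNat]
  generalize z 0 = x, z 1 = y, z 2 = w, conj (z 0) = x', conj (z 1) = y', conj (z 2) = w'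
  grind

lemma sum_sq_r_two :
    2 * Complex.normSq
        (functional (3 - 3 * p + (1 - p) * α) (3 * p + (p - 1) * α) ((1 - p) * α) z) +
      Complex.normSq (functional 1 (-1) 1 z) - 3 * Complex.normSq (z 1) + 3 * form α z =
    (12 + 24 * p) * Complex.normSq (functional
        (-9 / 2 + 5 * p / 2 + (-5 / 2 + 3 * p / 2) * α) 1 (3 / 2 - p + (3 / 2 - p) * α) z) +
      (6 * p - 3) * Complex.normSq
        (functional (-3 / 5 + p / 5 + (1 / 5 - 2 * p / 5) * α) 0 1 z) +
      (6 * p - 9) * Complex.normSq (z 0) := by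
  apply Complex.ofReal_injective
  replace hp : (p : ℂ) ^ 2 = p + 1 := by exact_mod_cast congrArg Complex.ofReal hp
  simp only [form, functional, Complex.ofReal_add, Complex.ofReal_sub, Complex.ofReal_mul,
    ← Complex.mul_conj, Complex.re_eq_add_conj, map_add, map_sub, map_mul, map_neg, map_div₀,
    map_one, map_zero, map_ofNat, Complex.conj_conj, Complex.conj_ofReal, hc,
    Complex.ofReal_ofNat]
  generalize z 0 = x, z 1 = y, z 2 = w, conj (z 0) = x', conj (z 1) = y', conj (z 2) = w'
  grind

lemma sum_sq_r_three :
    2 * Complex.normSq (functional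
        (-3 + 2 * p + (p - 1) * α) (3 + p + (1 - p) * α) (-p + (p - 1) * α) z) +
      Complex.normSq (functional 1 (-1) 1 z) - 3 * Complex.normSq (z 1) + 3 * form α z =
    (12 + 24 * p) * Complex.normSq (functional
        (-5 / 2 + 3 * p / 2 + (-3 / 2 + p) * α) 1
        (2 - 3 * p / 2 + (5 / 2 - 3 * p / 2) * α) z) +
      (6 * p - 3) * Complex.normSq
        (functional 1 0 (-7 / 5 + 4 * p / 5 + (-1 / 5 + 2 * p / 5) * α) z) +
      (6 * p - 9) * Complex.normSq (z 2) := by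
  apply Complex.ofReal_injective
  replace hp : (p : ℂ) ^ 2 = p + 1 := by exact_mod_cast congrArg Complex.ofReal hp
  simp only [form, functional, Complex.ofReal_add, Complex.ofReal_sub, Complex.ofReal_mul,
    ← Complex.mul_conj, Complex.re_eq_add_conj, map_add, map_sub, map_mul, map_neg, map_div₀,
    map_one, map_zero, map_ofNat, Complex.conj_conj, Complex.conj_ofReal, hc,
    Complex.ofReal_ofNat]
  generalize z 0 = x, z 1 = y, z 2 = w, conj (z 0) = x', conj (z 1) = y', conj (z 2) = w'
  grind

end SumsOfSquares

end TriangleGroup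

namespace TriangleGroup

open ComplexConjugate DihedralGroup

section Parameters

lemma golden_sq : Real.goldenRatio ^ 2 = Real.goldenRatio + 1 := Real.goldenRatio_sq

lemma s0_sq : (s0 : ℂ) ^ 2 = 4 * (Real.sqrt 5 : ℂ) - 5 := by
  have h5 : (2 : ℝ) ≤ Real.sqrt 5 := Real.le_sqrt_of_sq_le (by norm_num)
  have : s0 ^ 2 = 4 * Real.sqrt 5 - 5 := Real.sq_sqrt (by linarith)
  exact_mod_cast congrArg Complex.ofReal this

lemma ofReal_golden : (Real.goldenRatio : ℂ) = (1 + (Real.sqrt 5 : ℂ)) / 2 := by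
  simp [Real.goldenRatio]

lemma sqrt_five_sq : (Real.sqrt 5 : ℂ) ^ 2 = 5 := by
  exact_mod_cast congrArg Complex.ofReal (Real.sq_sqrt (show (0 : ℝ) ≤ 5 by norm_num))

lemma conj_alpha0 : conj alpha0 = (Real.goldenRatio : ℂ) - 2 - alpha0 := by
  rw [ofReal_golden]
  simp only [alpha0, map_add, map_sub, map_mul, map_neg, map_div₀, map_one, map_ofNat,
    Complex.conj_I, Complex.conj_ofReal]
  ring

lemma alpha0_sq : alpha0 ^ 2 =
    ((Real.goldenRatio : ℂ) - 2) * alpha0 - ((Real.goldenRatio : ℂ) + 1) := by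
  rw [ofReal_golden]
  have hs := s0_sq
  have h5 := sqrt_five_sq
  have hI := Complex.I_sq
  simp only [alpha0]
  grind

end Parameters

local notation "φ₀" => Real.goldenRatio

lemma functional_I1_mulVec (u v w : ℂ) (z : Fin 3 → ℂ) :
    functional u v w (I1 *ᵥ z) = functional u (-u - v) (u * alpha0 - w) z := by
  simp [functional, I1, mulVec, dotProduct, Fin.sum_univ_three]
  ring

lemma functional_I3_mulVec (u v w : ℂ) (z : Fin 3 → ℂ) :
    functional u v w (I3 *ᵥ z) = functional (w * conj alpha0 - u) (-v - w) w z := by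
  simp [functional, I3, mulVec, dotProduct, Fin.sum_univ_three]
  ring

lemma functional_I2_mulVec (u v w : ℂ) (z : Fin 3 → ℂ) :
    functional u v w (I2 *ᵥ z) = functional (-u - v) v (-v - w) z := by
  simp [functional, I2, mulVec, dotProduct, Fin.sum_univ_three]
  ring

lemma apply_zero_eq_functional (z : Fin 3 → ℂ) : z 0 = functional 1 0 0 z := by
  simp [functional]

lemma apply_one_eq_functional (z : Fin 3 → ℂ) : z 1 = functional 0 1 0 z := by
  simp [functional]

lemma apply_two_eq_functional (z : Fin 3 → ℂ) : z 2 = functional 0 0 1 z := by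
  simp [functional]

lemma form_mulVec {M : Matrix (Fin 3) (Fin 3) ℂ} (hM : M = I1 ∨ M = I2 ∨ M = I3)
    (z : Fin 3 → ℂ) : form alpha0 (M *ᵥ z) = form alpha0 z := by
  apply Complex.ofReal_injective
  have hp : (φ₀ : ℂ) ^ 2 = φ₀ + 1 := by exact_mod_cast congrArg Complex.ofReal golden_sq
  have hα := alpha0_sq
  have hc := conj_alpha0
  rcases hM with rfl | rfl | rfl
  all_goals
    simp only [form, apply_zero_eq_functional (_ *ᵥ _), apply_one_eq_functional (_ *ᵥ _),
      apply_two_eq_functional (_ *ᵥ _), functional_I1_mulVec, functional_I2_mulVec,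
      functional_I3_mulVec]
    simp only [functional, Complex.ofReal_add, Complex.ofReal_mul,
      ← Complex.mul_conj, Complex.re_eq_add_conj, map_add, map_sub, map_mul, map_neg,
      map_one, map_zero, map_ofNat, Complex.conj_conj, Complex.conj_ofReal, hc,
      Complex.ofReal_ofNat]
    generalize z 0 = x, z 1 = y, z 2 = w, conj (z 0) = x', conj (z 1) = y', conj (z 2) = w'
    grind

end TriangleGroup

namespace TriangleGroup

open ComplexConjugate DihedralGroup

local notation "φ₀" => Real.goldenRatio

/-- The squared modulus of the functional that is exchanged by `I2` with the middle coordinate. -/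
noncomputable def height (z : Fin 3 → ℂ) : ℝ := Complex.normSq (functional 1 (-1) 1 z)

lemma normSq_I2_mulVec (z : Fin 3 → ℂ) : Complex.normSq ((I2 *ᵥ z) 1) = height z := by
  rw [apply_one_eq_functional (I2 *ᵥ z), functional_I2_mulVec, height, ← Complex.normSq_neg]
  congr 1
  simp only [functional]
  ring

lemma height_I2_mulVec (z : Fin 3 → ℂ) : height (I2 *ᵥ z) = Complex.normSq (z 1) := by
  rw [height, functional_I2_mulVec, ← Complex.normSq_neg (z 1)]
  congr 1
  simp only [functional]
  ring

lemma height_I1_mulVec_I2_mulVec (z : Fin 3 → ℂ) :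
    height (I1 *ᵥ (I2 *ᵥ z)) = height (I1 *ᵥ z) := by
  simp only [height, functional_I1_mulVec, functional_I2_mulVec]
  rw [← Complex.normSq_neg]
  congr 1
  simp only [functional]
  ring

lemma height_I3_mulVec_I2_mulVec (z : Fin 3 → ℂ) :
    height (I3 *ᵥ (I2 *ᵥ z)) = height (I3 *ᵥ z) := by
  simp only [height, functional_I3_mulVec, functional_I2_mulVec]
  rw [← Complex.normSq_neg]
  congr 1
  simp only [functional]
  ring

lemma dihedral_induction {p : DihedralGroup 5 → Prop} (one : p 1)
    (sr_zero : ∀ s, p s → p (sr 0 * s)) (sr_four : ∀ s, p s → p (sr 4 * s))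
    (s : DihedralGroup 5) : p s := by
  have hsr0 : p (sr 0) := sr_zero _ one
  have hsr4 : p (sr 4) := sr_four _ one
  have hr1 : p (r 1) := sr_four _ hsr0
  have hr4 : p (r 4) := sr_zero _ hsr4
  have hsr3 : p (sr 3) := sr_four _ hr4
  have hsr1 : p (sr 1) := sr_zero _ hr1
  have hr2 : p (r 2) := sr_four _ hsr1
  have hr3 : p (r 3) := sr_zero _ hsr3
  have hsr2 : p (sr 2) := sr_zero _ hr2
  rcases s with i | i <;> fin_cases i <;> assumption

/-- The vector fixed up to sign by `I1` and `I3`. -/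
noncomputable def center : Fin 3 → ℂ := ![2 - alpha0, 3 - φ₀, 2 - conj alpha0]

section Decagon

variable {φ : DihedralGroup 5 →* GL (Fin 3) ℂ}

/-- The height of `φ s z`. -/
noncomputable def heightAt (φ : DihedralGroup 5 →* GL (Fin 3) ℂ) (s : DihedralGroup 5)
    (z : Fin 3 → ℂ) : ℝ := height ((φ s).1 *ᵥ z)

lemma map_mul_mulVec (s t : DihedralGroup 5) (z : Fin 3 → ℂ) :
    (φ (s * t)).1 *ᵥ z = (φ s).1 *ᵥ ((φ t).1 *ᵥ z) := by
  rw [map_mul, Units.val_mul, mulVec_mulVec]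

lemma heightAt_mulVec (s t : DihedralGroup 5) (z : Fin 3 → ℂ) :
    heightAt φ s ((φ t).1 *ᵥ z) = heightAt φ (s * t) z := by
  rw [heightAt, heightAt, map_mul_mulVec]

lemma heightAt_one (z : Fin 3 → ℂ) : heightAt φ 1 z = height z := by
  simp [heightAt]

variable (h0 : (φ (sr 0)).1 = I1) (h4 : (φ (sr 4)).1 = I3)
include h0 h4

lemma form_map_mulVec (s : DihedralGroup 5) (z : Fin 3 → ℂ) :
    form alpha0 ((φ s).1 *ᵥ z) = form alpha0 z := by
  induction s using dihedral_induction with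
  | one => simp
  | sr_zero s ih => rw [map_mul_mulVec, h0, form_mulVec (by simp), ih]
  | sr_four s ih => rw [map_mul_mulVec, h4, form_mulVec (by simp), ih]

lemma normSq_map_mulVec (s : DihedralGroup 5) (z : Fin 3 → ℂ) :
    Complex.normSq (((φ s).1 *ᵥ z) 1) = Complex.normSq (z 1) := by
  induction s using dihedral_induction with
  | one => simp
  | sr_zero s ih =>
    rw [map_mul_mulVec, h0, apply_one_eq_functional (I1 *ᵥ _), functional_I1_mulVec, ← ih,
      ← Complex.normSq_neg]
    simp [functional]
  | sr_four s ih =>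
    rw [map_mul_mulVec, h4, apply_one_eq_functional (I3 *ᵥ _), functional_I3_mulVec, ← ih,
      ← Complex.normSq_neg]
    simp [functional]

lemma map_mulVec_center (s : DihedralGroup 5) :
    (φ s).1 *ᵥ center = center ∨ (φ s).1 *ᵥ center = -center := by
  have hα := alpha0_sq
  have hc := conj_alpha0
  rw [ofReal_golden] at hα hc
  have e1 : I1 *ᵥ center = -center := by
    ext i
    fin_cases i
    all_goals
      simp [I1, center, mulVec, dotProduct, Fin.sum_univ_three]
      try grind
  have e3 : I3 *ᵥ center = -center := by
    ext i
    fin_cases i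
    all_goals
      simp [I3, center, mulVec, dotProduct, Fin.sum_univ_three]
      try grind
  induction s using dihedral_induction with
  | one => simp
  | sr_zero s ih =>
    rw [map_mul_mulVec, h0]
    rcases ih with ih | ih <;> simp [ih, e1, mulVec_neg]
  | sr_four s ih =>
    rw [map_mul_mulVec, h4]
    rcases ih with ih | ih <;> simp [ih, e3, mulVec_neg]

lemma heightAt_center (s : DihedralGroup 5) : heightAt φ s center = 9 := by
  have : height center = 9 := by
    have : functional 1 (-1) 1 center = 3 := by
      simp [functional, center, conj_alpha0]
      ring
    rw [height, this]
    norm_num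
  rcases map_mulVec_center h0 h4 s with h | h
  · rw [heightAt, h, this]
  · rw [heightAt, h, ← this, height, height, ← Complex.normSq_neg]
    congr 1
    simp only [functional, Pi.neg_apply]
    ring

omit h0 h4 in
lemma normSq_center_lt : Complex.normSq (center 1) < 9 := by
  have : center 1 = ((3 - φ₀ : ℝ) : ℂ) := by simp [center]
  rw [this, Complex.normSq_ofReal]
  nlinarith [Real.one_lt_goldenRatio, Real.goldenRatio_lt_two]

omit h0 h4 in
lemma form_center_neg : form alpha0 center < 0 := by
  have : form alpha0 center = -(φ₀ * (3 - φ₀)) := by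
    apply Complex.ofReal_injective
    have hp : (φ₀ : ℂ) ^ 2 = φ₀ + 1 := by exact_mod_cast congrArg Complex.ofReal golden_sq
    have hα := alpha0_sq
    have hc := conj_alpha0
    simp only [form, center, Complex.ofReal_add, Complex.ofReal_mul, ← Complex.mul_conj,
      Complex.re_eq_add_conj, map_sub, map_mul, map_ofNat, Complex.conj_ofReal, hc, Complex.ofReal_ofNat, Complex.ofReal_sub, Complex.ofReal_neg,
      cons_val]
    grind
  rw [this]
  nlinarith [Real.one_lt_goldenRatio, Real.goldenRatio_lt_two]

lemma functional_map_mulVec (z : Fin 3 → ℂ) :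
    functional 1 (-1) 1 ((φ (sr 4)).1 *ᵥ z) = functional (φ₀ - 3 - alpha0) 0 1 z ∧
    functional 1 (-1) 1 ((φ (sr 0)).1 *ᵥ z) = functional 1 0 (-1 + alpha0) z ∧
    functional 1 (-1) 1 ((φ (r 1)).1 *ᵥ z) =
      functional (φ₀ - 3 - alpha0) (3 - φ₀ + alpha0) (φ₀ - alpha0) z ∧
    functional 1 (-1) 1 ((φ (r 4)).1 *ᵥ z) =
      functional (2 + alpha0) (1 - alpha0) (-1 + alpha0) z ∧
    functional 1 (-1) 1 ((φ (sr 3)).1 *ᵥ z) =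
      functional (3 - 3 * φ₀ + (1 - φ₀) * alpha0) (-3) (φ₀ - alpha0) z ∧
    functional 1 (-1) 1 ((φ (r 2)).1 *ᵥ z) = functional (3 - 3 * φ₀ + (1 - φ₀) * alpha0)
      (3 * φ₀ + (φ₀ - 1) * alpha0) ((1 - φ₀) * alpha0) z ∧
    functional 1 (-1) 1 ((φ (sr 2)).1 *ᵥ z) = functional (-3 + 2 * φ₀ + (φ₀ - 1) * alpha0)
      (-3 * φ₀) ((1 - φ₀) * alpha0) z ∧
    functional 1 (-1) 1 ((φ (r 3)).1 *ᵥ z) = functional (-3 + 2 * φ₀ + (φ₀ - 1) * alpha0)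
      (3 + φ₀ + (1 - φ₀) * alpha0) (-φ₀ + (φ₀ - 1) * alpha0) z ∧
    functional 1 (-1) 1 ((φ (sr 1)).1 *ᵥ z) =
      functional (2 + alpha0) (-3) (-φ₀ + (φ₀ - 1) * alpha0) z := by
  have hp : (φ₀ : ℂ) ^ 2 = φ₀ + 1 := by exact_mod_cast congrArg Complex.ofReal golden_sq
  have hα := alpha0_sq
  have hc := conj_alpha0
  have hmul := map_mul_mulVec (φ := φ)
  have e1 : r 1 = sr 4 * sr (0 : ZMod 5) := rfl
  have e2 : r 4 = sr 0 * sr (4 : ZMod 5) := rfl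
  have e3 : sr 3 = sr 4 * (sr 0 * sr (4 : ZMod 5)) := rfl
  have e4 : r 2 = sr 4 * (sr 0 * (sr 4 * sr (0 : ZMod 5))) := rfl
  have e5 : sr 2 = sr 4 * (sr 0 * (sr 4 * (sr 0 * sr (4 : ZMod 5)))) := rfl
  have e6 : r 3 = sr 0 * (sr 4 * (sr 0 * sr (4 : ZMod 5))) := rfl
  have e7 : sr 1 = sr 0 * (sr 4 * sr (0 : ZMod 5)) := rfl
  rw [e1, e2, e3, e4, e5, e6, e7]
  simp only [hmul, h0, h4, functional_I1_mulVec, functional_I3_mulVec, hc]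
  refine ⟨?_, ?_, ?_, ?_, ?_, ?_, ?_, ?_, ?_⟩ <;> congr 1 <;> grind

lemma normSq_lt_heightAt {z : Fin 3 → ℂ} (hz : form alpha0 z < 0)
    (hlt : heightAt φ 1 z < Complex.normSq (z 1)) {s : DihedralGroup 5}
    (hs : s ≠ 1 ∧ s ≠ sr 0 ∧ s ≠ sr 4 ∧ s ≠ r 1 ∧ s ≠ r 4) :
    Complex.normSq (z 1) < heightAt φ s z := by
  obtain ⟨-, -, -, -, hsr3, hr2, hsr2, hr3, hsr1⟩ := functional_map_mulVec h0 h4 z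
  rw [heightAt_one, height] at hlt
  rw [heightAt, height]
  have hp := golden_sq
  have hp1 := Real.one_lt_goldenRatio
  have hp2 : 0 < 6 * φ₀ - 9 := by nlinarith
  have hα := alpha0_sq
  have hc := conj_alpha0
  have key : ∀ (c : ℝ) (u v w : ℂ), 0 < c → 0 ≤ c * Complex.normSq (functional u v w z) :=
    fun c u v w h => mul_nonneg h.le (Complex.normSq_nonneg _)
  obtain rfl | rfl | rfl | rfl | rfl :
      s = sr 3 ∨ s = r 2 ∨ s = sr 2 ∨ s = r 3 ∨ s = sr 1 := by
    revert s
    decide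
  · have := sum_sq_sr_three hp hc hα z
    rw [hsr3]
    linarith [key 9 1 (-1 / 3 + φ₀ / 3 + (1 / 3 - φ₀ / 3) * alpha0) (φ₀ / 3 * alpha0)
      (by norm_num), key (4 + 4 * φ₀) 0 1 (-1 / 2 + (1 - φ₀ / 2) * alpha0) (by linarith)]
  · have := sum_sq_r_two hp hc hα z
    rw [hr2]
    linarith [key (12 + 24 * φ₀) (-9 / 2 + 5 * φ₀ / 2 + (-5 / 2 + 3 * φ₀ / 2) * alpha0) 1
      (3 / 2 - φ₀ + (3 / 2 - φ₀) * alpha0) (by linarith), key (6 * φ₀ - 3)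
      (-3 / 5 + φ₀ / 5 + (1 / 5 - 2 * φ₀ / 5) * alpha0) 0 1 (by linarith),
      mul_nonneg hp2.le (Complex.normSq_nonneg (z 0))]
  · have := sum_sq_sr_two hp hc hα z
    rw [hsr2]
    linarith [key 6 1 (-1 / 2 + alpha0 / 2) ((-1 / 2 + φ₀ / 2) * alpha0) (by norm_num),
      key (6 + 9 * φ₀) 0 1 (-7 / 2 + 2 * φ₀ + (1 - φ₀ / 2) * alpha0) (by linarith),
      mul_nonneg hp2.le (Complex.normSq_nonneg (z 2))]
  · have := sum_sq_r_three hp hc hα z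
    rw [hr3]
    linarith [key (12 + 24 * φ₀) (-5 / 2 + 3 * φ₀ / 2 + (-3 / 2 + φ₀) * alpha0) 1
      (2 - 3 * φ₀ / 2 + (5 / 2 - 3 * φ₀ / 2) * alpha0) (by linarith), key (6 * φ₀ - 3) 1 0
      (-7 / 5 + 4 * φ₀ / 5 + (-1 / 5 + 2 * φ₀ / 5) * alpha0) (by linarith),
      mul_nonneg hp2.le (Complex.normSq_nonneg (z 2))]
  · have := sum_sq_sr_one hp hc hα z
    rw [hsr1]
    linarith [key 12 (-3 / 4 - alpha0 / 4) 1 (-1 / 4 + φ₀ / 4 + (1 / 4 - φ₀ / 4) * alpha0)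
      (by norm_num), key 3 1 0 alpha0 (by norm_num)]

lemma normSq_lt_heightAt_r_four {z : Fin 3 → ℂ} (hz : form alpha0 z < 0)
    (hlt : heightAt φ 1 z < heightAt φ (sr 4) z) :
    Complex.normSq (z 1) < heightAt φ (r 4) z := by
  obtain ⟨h, -, -, h', -⟩ := functional_map_mulVec h0 h4 z
  rw [heightAt_one, heightAt, height, height, h] at hlt
  rw [heightAt, height, h']
  have := sum_sq_r_four golden_sq conj_alpha0 alpha0_sq z
  linarith [Complex.normSq_nonneg (functional (1 / 2 - φ₀ / 2 + alpha0 / 2) 1 (-1) z)]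

lemma normSq_lt_heightAt_r_one {z : Fin 3 → ℂ} (hz : form alpha0 z < 0)
    (hlt : heightAt φ 1 z < heightAt φ (sr 0) z) :
    Complex.normSq (z 1) < heightAt φ (r 1) z := by
  obtain ⟨-, h, h', -⟩ := functional_map_mulVec h0 h4 z
  rw [heightAt_one, heightAt, height, height, h] at hlt
  rw [heightAt, height, h']
  have := sum_sq_r_one golden_sq conj_alpha0 alpha0_sq z
  linarith [Complex.normSq_nonneg (functional 1 (-1) (1 / 2 + alpha0 / 2) z)]

end Decagon
end TriangleGroup

namespace TriangleGroup

open ComplexConjugate DihedralGroup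

/-- The states of the automaton recognising reduced sequences of letters. -/
inductive Side
  | none | left | right

/-- The transition function of the automaton, which reads sequences from left to right. -/
def Side.next (σ : Side) (k : DihedralGroup 5) : Side :=
  if k = r 4 then left else if k = r 1 then right else
  match σ with
  | none => none
  | left => if k = sr 3 then left else none
  | right => if k = sr 1 then right else none

/-- The letters allowed in a given state. -/
def Side.Allows (σ : Side) (k : DihedralGroup 5) : Prop :=
  k ≠ 1 ∧ k ≠ sr 0 ∧ k ≠ sr 4 ∧ (σ = left → k ≠ r 1) ∧ (σ = right → k ≠ r 4)

/-- The region of negative vectors attached to a state. -/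
def Side.region (φ : DihedralGroup 5 →* GL (Fin 3) ℂ) (σ : Side) : Set (Fin 3 → ℂ) :=
  {z | form alpha0 z < 0 ∧ Complex.normSq (z 1) < heightAt φ 1 z ∧
    (σ = left → Complex.normSq (z 1) < heightAt φ (sr 4) z) ∧
    (σ = right → Complex.normSq (z 1) < heightAt φ (sr 0) z)}

section PingPong

variable {φ : DihedralGroup 5 →* GL (Fin 3) ℂ} {b : GL (Fin 3) ℂ}
  (h0 : (φ (sr 0)).1 = I1) (h4 : (φ (sr 4)).1 = I3) (hb : b.1 = I2)
include h0 h4 hb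

lemma mulVec_mem_region {σ : Side} {k : DihedralGroup 5} (hk : σ.Allows k) {z : Fin 3 → ℂ}
    (hz : z ∈ (σ.next k).region φ) : (φ k * b).1 *ᵥ z ∈ σ.region φ := by
  obtain ⟨hneg, hlt, hl, hr⟩ := hz
  rw [Units.val_mul, ← mulVec_mulVec, hb]
  set y := I2 *ᵥ z with hy
  replace hneg : form alpha0 y < 0 := by rwa [hy, form_mulVec (by simp)]
  have ht : Complex.normSq (y 1) = heightAt φ 1 z := by rw [hy, normSq_I2_mulVec, heightAt_one]
  have hq : heightAt φ 1 y = Complex.normSq (z 1) := by rw [heightAt_one, hy, height_I2_mulVec]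
  have hq4 : heightAt φ (sr 4) y = heightAt φ (sr 4) z := by
    rw [heightAt, h4, hy, height_I3_mulVec_I2_mulVec, ← h4, heightAt]
  have hq0 : heightAt φ (sr 0) y = heightAt φ (sr 0) z := by
    rw [heightAt, h0, hy, height_I1_mulVec_I2_mulVec, ← h0, heightAt]
  rw [← hq, ← ht] at hlt
  rw [← hq, ← hq4] at hl
  rw [← hq, ← hq0] at hr
  have good := fun s => normSq_lt_heightAt h0 h4 hneg hlt (s := s)
  have good4 := fun h => normSq_lt_heightAt_r_four h0 h4 hneg (hl h)
  have good1 := fun h => normSq_lt_heightAt_r_one h0 h4 hneg (hr h)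
  simp only [Side.region, Set.mem_ofPred_eq, form_map_mulVec h0 h4, normSq_map_mulVec h0 h4,
    heightAt_mulVec, one_mul]
  refine ⟨hneg, ?_, ?_, ?_⟩
  · by_cases k4 : k = r 4
    · subst k4
      exact good4 (by simp [Side.next])
    by_cases k1 : k = r 1
    · subst k1
      exact good1 (by simp [Side.next]; decide)
    exact good k ⟨hk.1, hk.2.1, hk.2.2.1, k1, k4⟩
  · rintro rfl
    have h1 := hk.2.2.2.1 rfl
    by_cases k3 : k = sr 3
    · subst k3
      exact good4 (by simp [Side.next])
    refine good _ ?_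
    have := hk.1
    have := hk.2.1
    have := hk.2.2.1
    clear good good4 good1 hl hr hk
    revert k
    decide
  · rintro rfl
    have h1 := hk.2.2.2.2 rfl
    by_cases k3 : k = sr 1
    · subst k3
      exact good1 (by simp [Side.next])
    refine good _ ?_
    have := hk.1
    have := hk.2.1
    have := hk.2.2.1
    clear good good4 good1 hl hr hk
    revert k
    decide

omit hb in
lemma center_mem_region (σ : Side) : center ∈ σ.region φ := by
  simp only [Side.region, Set.mem_ofPred_eq, heightAt_center h0 h4]
  exact ⟨form_center_neg, normSq_center_lt, fun _ => normSq_center_lt, fun _ => normSq_center_lt⟩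

/-- The sequence of states visited while reading a sequence of letters. -/
def sides (f : ℕ → DihedralGroup 5) : ℕ → Side
  | 0 => .none
  | n + 1 => (sides f n).next (f n)

omit h0 h4 hb in
lemma exists_of_sides_eq_left (f : ℕ → DihedralGroup 5) (n : ℕ) (h : sides f n = .left) :
    ∃ i m, n = i + 1 + m ∧ f i = r 4 ∧ ∀ j < m, f (i + 1 + j) = sr 3 := by
  induction n with
  | zero => cases h
  | succ n ih =>
    by_cases k4 : f n = r 4
    · exact ⟨n, 0, rfl, k4, by simp⟩
    have : sides f n = .left ∧ f n = sr 3 := by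
      by_cases k1 : f n = r 1
      · simp only [sides, Side.next, if_neg k4, if_pos k1] at h
        cases h
      simp only [sides, Side.next, if_neg k4, if_neg k1] at h
      revert h
      cases sides f n <;> simp
      split <;> simp
    obtain ⟨i, m, rfl, hi, hm⟩ := ih this.1
    refine ⟨i, m + 1, rfl, hi, fun j hj => ?_⟩
    rcases (Nat.lt_succ_iff.mp hj).lt_or_eq with h' | rfl
    · exact hm j h'
    · exact this.2

omit h0 h4 hb in
lemma exists_of_sides_eq_right (f : ℕ → DihedralGroup 5) (n : ℕ) (h : sides f n = .right) :
    ∃ i m, n = i + 1 + m ∧ f i = r 1 ∧ ∀ j < m, f (i + 1 + j) = sr 1 := by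
  induction n with
  | zero => cases h
  | succ n ih =>
    by_cases k4 : f n = r 1
    · exact ⟨n, 0, rfl, k4, by simp⟩
    have : sides f n = .right ∧ f n = sr 1 := by
      by_cases k1 : f n = r 4
      · simp only [sides, Side.next, if_pos k1] at h
        cases h
      simp only [sides, Side.next, if_neg k1, if_neg k4] at h
      revert h
      cases sides f n <;> simp
      split <;> simp
    obtain ⟨i, m, rfl, hi, hm⟩ := ih this.1
    refine ⟨i, m + 1, rfl, hi, fun j hj => ?_⟩
    rcases (Nat.lt_succ_iff.mp hj).lt_or_eq with h' | rfl
    · exact hm j h'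
    · exact this.2

omit h0 h4 hb in
lemma Reduced.allows {f : ℕ → DihedralGroup 5} (hf : Reduced f) (n : ℕ) :
    (sides f n).Allows (f n) := by
  refine ⟨hf.ne_one n, hf.ne_sr_zero n, hf.ne_sr_four n, fun h => ?_, fun h => ?_⟩
  · obtain ⟨i, m, rfl, hi, hm⟩ := exists_of_sides_eq_left f n h
    exact hf.ne_r_one i m hi hm
  · obtain ⟨i, m, rfl, hi, hm⟩ := exists_of_sides_eq_right f n h
    exact hf.ne_r_four i m hi hm

lemma word_mulVec_mem_region {f : ℕ → DihedralGroup 5} (hf : Reduced f) (i n : ℕ)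
    {z : Fin 3 → ℂ} (hz : z ∈ (sides f (i + n)).region φ) :
    (word φ b f i n).1 *ᵥ z ∈ (sides f i).region φ := by
  induction n generalizing i with
  | zero => simpa using hz
  | succ n ih =>
    rw [word_succ, Units.val_mul, ← mulVec_mulVec]
    refine mulVec_mem_region h0 h4 hb (hf.allows i) (ih (i + 1) ?_)
    rwa [add_assoc, add_comm 1 n]

/-- A nonempty reduced word does not fix the negative line spanned by `center`. -/
lemma word_mulVec_center_ne {f : ℕ → DihedralGroup 5} (hf : Reduced f) {n : ℕ} (hn : 0 < n)
    (c : ℂ) : (word φ b f 0 n).1 *ᵥ center ≠ c • center := by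
  obtain ⟨n, rfl⟩ := Nat.exists_eq_succ_of_ne_zero hn.ne'
  intro h
  have hmem := word_mulVec_mem_region h0 h4 hb hf 1 n
    (center_mem_region h0 h4 (sides f (1 + n)))
  rw [Nat.succ_eq_add_one, word_succ, Units.val_mul, ← mulVec_mulVec] at h
  set z := (word φ b f (0 + 1) n).1 *ᵥ center with hz
  have hlt := hmem.2.1
  obtain ⟨d, hd⟩ : ∃ d : ℂ, I2 *ᵥ z = d • center := by
    have e : I2 *ᵥ z = (φ (f 0)⁻¹).1 *ᵥ (c • center) := by
      rw [← h, Units.val_mul, ← mulVec_mulVec, ← map_mul_mulVec, inv_mul_cancel, map_one, hb,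
        Units.val_one, one_mulVec]
    rw [e, mulVec_smul]
    rcases map_mulVec_center h0 h4 (f 0)⁻¹ with h' | h'
    · exact ⟨c, by rw [h']⟩
    · exact ⟨-c, by rw [h', smul_neg, neg_smul]⟩
  have ht : heightAt φ 1 z = Complex.normSq d * Complex.normSq (center 1) := by
    rw [heightAt_one, ← normSq_I2_mulVec, hd, Pi.smul_apply, smul_eq_mul, map_mul]
  have hq : Complex.normSq (z 1) = Complex.normSq d * 9 := by
    rw [← height_I2_mulVec, hd, ← heightAt_center h0 h4 1, heightAt_one, height, height,
      ← map_mul]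
    congr 1
    simp only [functional, Pi.smul_apply, smul_eq_mul]
    ring
  change Complex.normSq (z 1) < heightAt φ 1 z at hlt
  rw [ht, hq] at hlt
  nlinarith [Complex.normSq_nonneg d, normSq_center_lt]

end PingPong
end TriangleGroup

namespace TriangleGroup

open ComplexConjugate DihedralGroup

lemma I1_mul_I1 : I1 * I1 = 1 := by
  ext i j
  fin_cases i <;> fin_cases j <;> simp [I1, mul_apply, Fin.sum_univ_three]

lemma I2_mul_I2 : I2 * I2 = 1 := by
  ext i j
  fin_cases i <;> fin_cases j <;> simp [I2, mul_apply, Fin.sum_univ_three]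

lemma I3_mul_I3 : I3 * I3 = 1 := by
  ext i j
  fin_cases i <;> fin_cases j <;> simp [I3, mul_apply, Fin.sum_univ_three]

lemma I1_braid_I2 : I1 * I2 * I1 = I2 * I1 * I2 := by
  ext i j
  fin_cases i <;> fin_cases j <;> simp [I1, I2, mul_apply, Fin.sum_univ_three, add_comm]

lemma I3_braid_I2 : I3 * I2 * I3 = I2 * I3 * I2 := by
  ext i j
  fin_cases i <;> fin_cases j <;> simp [I3, I2, mul_apply, Fin.sum_univ_three, add_comm]

lemma I1_braid_I3 : I1 * I3 * I1 * I3 * I1 = I3 * I1 * I3 * I1 * I3 := by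
  have hp : (Real.goldenRatio : ℂ) ^ 2 = Real.goldenRatio + 1 := by
    exact_mod_cast congrArg Complex.ofReal golden_sq
  have hα := alpha0_sq
  have hc := conj_alpha0
  rw [I1, I3]
  simp only [mul_fin_three, hc]
  congr! 3 <;> grind

end TriangleGroup

namespace TriangleGroup

open DihedralGroup

lemma word_map {G H : Type*} [Group G] [Group H] (ψ : G →* H) (φ : DihedralGroup 5 →* G) (b : G)
    (f : ℕ → DihedralGroup 5) (i n : ℕ) :
    ψ (word φ b f i n) = word (ψ.comp φ) (ψ b) f i n := by
  induction n generalizing i with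
  | zero => simp
  | succ n ih => simp [word_succ, ih]

section Generators

variable {a₁ a₂ a₃ : GL (Fin 3) ℂ}

/-- Membership in the even-length subgroup, up to left multiplication by `a₁` for elements of
odd length. -/
def HasParity (a₁ a₂ a₃ : GL (Fin 3) ℂ) (h : GL (Fin 3) ℂ × ℤˣ) : Prop :=
  h.2 = 1 ∧ h.1 ∈ Subgroup.closure {a₁ * a₂, a₂ * a₃} ∨
  h.2 = -1 ∧ a₁ * h.1 ∈ Subgroup.closure {a₁ * a₂, a₂ * a₃}

variable (h₁ : a₁ * a₁ = 1) (h₂ : a₂ * a₂ = 1) (h₃ : a₃ * a₃ = 1)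
include h₁ h₂ h₃

lemma HasParity.mul_left {h : GL (Fin 3) ℂ × ℤˣ} (hh : HasParity a₁ a₂ a₃ h)
    {a : GL (Fin 3) ℂ} (ha : a = a₁ ∨ a = a₂ ∨ a = a₃) :
    HasParity a₁ a₂ a₃ ((a, -1) * h) := by
  have hK₁ : a₁ * a₂ ∈ Subgroup.closure {a₁ * a₂, a₂ * a₃} := Subgroup.subset_closure (by simp)
  have hK₂ : a₂ * a₃ ∈ Subgroup.closure {a₁ * a₂, a₂ * a₃} := Subgroup.subset_closure (by simp)
  have hK₃ : a₁ * a₃ ∈ Subgroup.closure {a₁ * a₂, a₂ * a₃} := by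
    have e : a₁ * a₃ = a₁ * a₂ * (a₂ * a₃) := by
      rw [mul_assoc, ← mul_assoc a₂, h₂, one_mul]
    rw [e]
    exact mul_mem hK₁ hK₂
  obtain ⟨h, ε⟩ := h
  rcases hh with ⟨rfl, hh⟩ | ⟨rfl, hh⟩
  · refine Or.inr ⟨by simp, ?_⟩
    change a₁ * (a * h) ∈ _
    rw [← mul_assoc]
    refine mul_mem ?_ hh
    rcases ha with rfl | rfl | rfl
    · rw [h₁]; exact one_mem _
    · exact hK₁
    · exact hK₃
  · refine Or.inl ⟨by simp, ?_⟩
    change a * h ∈ _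
    change a₁ * h ∈ _ at hh
    have ha' : a * a = 1 := by rcases ha with rfl | rfl | rfl <;> assumption
    have e : a * h = (a₁ * a)⁻¹ * (a₁ * h) := by
      rw [_root_.mul_inv_rev, inv_eq_of_mul_eq_one_left ha', mul_assoc, inv_mul_cancel_left]
    rw [e]
    refine mul_mem (inv_mem ?_) hh
    rcases ha with rfl | rfl | rfl
    · rw [h₁]; exact one_mem _
    · exact hK₁
    · exact hK₃

lemma hasParity_of_mem {φ : DihedralGroup 5 →* GL (Fin 3) ℂ × ℤˣ} (h0 : φ (sr 0) = (a₁, -1))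
    (h4 : φ (sr 4) = (a₃, -1)) {h : GL (Fin 3) ℂ × ℤˣ}
    (hh : h ∈ Subgroup.closure (Set.range φ ∪ {(a₂, -1)})) : HasParity a₁ a₂ a₃ h := by
  have hφ : ∀ s y, HasParity a₁ a₂ a₃ y → HasParity a₁ a₂ a₃ (φ s * y) := fun s y hy => by
    induction s using dihedral_induction with
    | one => simpa using hy
    | sr_zero s ih =>
      rw [map_mul, mul_assoc, h0]
      exact ih.mul_left h₁ h₂ h₃ (by simp)
    | sr_four s ih =>
      rw [map_mul, mul_assoc, h4]
      exact ih.mul_left h₁ h₂ h₃ (by simp)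
  induction hh using Subgroup.closure_induction_left with
  | one => exact Or.inl ⟨rfl, one_mem _⟩
  | mul_left x hx y _ hy =>
    rcases hx with ⟨s, rfl⟩ | rfl
    · exact hφ s y hy
    · exact hy.mul_left h₁ h₂ h₃ (by simp)
  | inv_mul_cancel x hx y _ hy =>
    rcases hx with ⟨s, rfl⟩ | rfl
    · rw [← map_inv]
      exact hφ s⁻¹ y hy
    · have e : ((a₂, -1) : GL (Fin 3) ℂ × ℤˣ)⁻¹ = (a₂, -1) :=
        Prod.ext (inv_eq_of_mul_eq_one_left h₂) (by simp)
      rw [e]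
      exact hy.mul_left h₁ h₂ h₃ (by simp)

lemma exists_conj_zpow {h : GL (Fin 3) ℂ × ℤˣ} (hh : HasParity a₁ a₂ a₃ h) {g : GL (Fin 3) ℂ}
    (hg : h.1 * g * h.1⁻¹ = a₁ * a₂ ∨ h.1 * g * h.1⁻¹ = a₃ * a₂ ∨
      ∃ n : ℕ, h.1 * g * h.1⁻¹ = (a₃ * a₁) ^ n) :
    ∃ k ∈ Subgroup.closure {a₁ * a₂, a₂ * a₃}, ∃ n : ℤ,
      k * g * k⁻¹ = (a₁ * a₂) ^ n ∨ k * g * k⁻¹ = (a₂ * a₃) ^ n ∨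
        k * g * k⁻¹ = (a₃ * a₁) ^ n := by
  have i₁ := inv_eq_of_mul_eq_one_left h₁
  have i₂ := inv_eq_of_mul_eq_one_left h₂
  have i₃ := inv_eq_of_mul_eq_one_left h₃
  obtain ⟨h, ε⟩ := h
  simp only at hg
  rcases hh with ⟨-, hh⟩ | ⟨-, hh⟩
  · refine ⟨h, hh, ?_⟩
    rcases hg with hg | hg | ⟨n, hg⟩
    · exact ⟨1, Or.inl (by rw [hg, zpow_one])⟩
    · exact ⟨-1, Or.inr (Or.inl (by rw [hg, _root_.zpow_neg_one, _root_.mul_inv_rev, i₂, i₃]))⟩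
    · exact ⟨n, Or.inr (Or.inr (by rw [hg, zpow_natCast]))⟩
  · have hconj : ∀ a : GL (Fin 3) ℂ, (a * h) * g * (a * h)⁻¹ = a * (h * g * h⁻¹) * a⁻¹ :=
      fun a => by group
    rcases hg with hg | hg | ⟨n, hg⟩
    · refine ⟨a₁ * h, hh, -1, Or.inl ?_⟩
      rw [hconj, hg, _root_.zpow_neg_one, _root_.mul_inv_rev, i₁, i₂, ← mul_assoc, h₁, one_mul]
    · refine ⟨a₂ * h, ?_, 1, Or.inr (Or.inl ?_)⟩
      · have e : a₂ * h = (a₁ * a₂)⁻¹ * (a₁ * h) := by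
          rw [_root_.mul_inv_rev, i₂, mul_assoc, inv_mul_cancel_left]
        rw [e]
        exact mul_mem (inv_mem (Subgroup.subset_closure (by simp))) hh
      · rw [hconj, hg, zpow_one, ← mul_assoc, mul_inv_cancel_right]
    · refine ⟨a₁ * h, hh, -n, Or.inr (Or.inr ?_)⟩
      rw [hconj, hg, ← conj_pow, _root_.zpow_neg, zpow_natCast, ← inv_pow, _root_.mul_inv_rev, i₁, i₃,
        mul_assoc, mul_assoc, h₁, mul_one]

end Generators


/-- The homomorphism from the dihedral group to the group generated by `I1` and `I3`, recording
the parity of the word length. -/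
lemma exists_dihedralHom {a₁ a₃ : GL (Fin 3) ℂ} (e₁ : a₁.1 = I1) (e₃ : a₃.1 = I3) :
    ∃ φ : DihedralGroup 5 →* GL (Fin 3) ℂ × ℤˣ,
      φ (sr 0) = (a₁, -1) ∧ φ (sr 4) = (a₃, -1) ∧
      (∀ i, φ (r i) = ((a₃ * a₁) ^ i.val, 1)) ∧ ∀ i, (φ (sr i)).2 = -1 := by
  have h₁ : a₁ * a₁ = 1 := Units.ext (by rw [Units.val_mul, e₁, I1_mul_I1, Units.val_one])
  have h₃ : a₃ * a₃ = 1 := Units.ext (by rw [Units.val_mul, e₃, I3_mul_I3, Units.val_one])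
  have h13 : a₁ * a₃ * a₁ * a₃ * a₁ = a₃ * a₁ * a₃ * a₁ * a₃ :=
    Units.ext (by simp only [Units.val_mul, e₁, e₃, I1_braid_I3])
  have h5 : (a₃ * a₁) ^ 5 = 1 := by
    calc (a₃ * a₁) ^ 5 = a₃ * (a₁ * a₃ * a₁ * a₃ * a₁) * a₃ * a₁ * a₃ * a₁ := by
          simp only [pow_succ, pow_zero, one_mul, mul_assoc]
      _ = (a₃ * a₃) * a₁ * a₃ * a₁ * (a₃ * a₃) * a₁ * a₃ * a₁ := by rw [h13]; group
      _ = a₁ * a₃ * (a₁ * a₁) * a₃ * a₁ := by rw [h₃]; group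
      _ = a₁ * (a₃ * a₃) * a₁ := by rw [h₁]; group
      _ = 1 := by rw [h₃, mul_one, h₁]
  have hinv₁ := inv_eq_of_mul_eq_one_left h₁
  have hinv₃ := inv_eq_of_mul_eq_one_left h₃
  have hconj : a₁ * (a₃ * a₁) * a₁ = (a₃ * a₁)⁻¹ := by
    rw [_root_.mul_inv_rev, hinv₁, hinv₃, mul_assoc, mul_assoc, h₁, mul_one]
  refine ⟨dihedralHom (a₁, -1) (a₃ * a₁, 1) (Prod.ext h₁ (by simp)) (Prod.ext h5 (by simp))
    (Prod.ext hconj (by simp)), ?_, ?_, fun i => ?_, fun i => ?_⟩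
  · change (a₁, (-1 : ℤˣ)) * (a₃ * a₁, 1) ^ 0 = _
    rw [pow_zero, mul_one]
  · change (a₁, (-1 : ℤˣ)) * (a₃ * a₁, 1) ^ 4 = _
    refine Prod.ext ?_ (by simp)
    change a₁ * (a₃ * a₁) ^ 4 = a₃
    rw [show (a₃ * a₁) ^ 4 = (a₃ * a₁)⁻¹ from eq_inv_of_mul_eq_one_left (by rw [← pow_succ, h5]),
      ← hconj, mul_assoc, mul_assoc, h₁, mul_one, ← mul_assoc, h₁, one_mul]
  · change (a₃ * a₁, (1 : ℤˣ)) ^ i.val = _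
    simp
  · change ((a₁, (-1 : ℤˣ)) * (a₃ * a₁, 1) ^ i.val).2 = _
    simp

end TriangleGroup

theorem elliptic_elements_classification
    (g1 g2 g3 : GL (Fin 3) ℂ)
    (h1 : (g1 : Matrix (Fin 3) (Fin 3) ℂ) = I1 * I2)
    (h2 : (g2 : Matrix (Fin 3) (Fin 3) ℂ) = I2 * I3)
    (h3 : (g3 : Matrix (Fin 3) (Fin 3) ℂ) = I3 * I1) :
    ∀ x ∈ Subgroup.closure {P g1, P g2}, IsOfFinOrder x →
      ∃ h ∈ Subgroup.closure {P g1, P g2}, ∃ n : ℤ,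
        h * x * h⁻¹ = (P g1) ^ n ∨
        h * x * h⁻¹ = (P g2) ^ n ∨
        h * x * h⁻¹ = (P g3) ^ n := by
  open TriangleGroup DihedralGroup in
  intro x hx hfin
  obtain ⟨a₁, e₁⟩ : ∃ a : GL (Fin 3) ℂ, a.1 = I1 := ⟨⟨I1, I1, I1_mul_I1, I1_mul_I1⟩, rfl⟩
  obtain ⟨a₂, e₂⟩ : ∃ a : GL (Fin 3) ℂ, a.1 = I2 := ⟨⟨I2, I2, I2_mul_I2, I2_mul_I2⟩, rfl⟩
  obtain ⟨a₃, e₃⟩ : ∃ a : GL (Fin 3) ℂ, a.1 = I3 := ⟨⟨I3, I3, I3_mul_I3, I3_mul_I3⟩, rfl⟩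
  have h₁ : a₁ * a₁ = 1 := Units.ext (by rw [Units.val_mul, e₁, I1_mul_I1, Units.val_one])
  have h₂ : a₂ * a₂ = 1 := Units.ext (by rw [Units.val_mul, e₂, I2_mul_I2, Units.val_one])
  have h₃ : a₃ * a₃ = 1 := Units.ext (by rw [Units.val_mul, e₃, I3_mul_I3, Units.val_one])
  obtain rfl : g1 = a₁ * a₂ := Units.ext (by rw [h1, Units.val_mul, e₁, e₂])
  obtain rfl : g2 = a₂ * a₃ := Units.ext (by rw [h2, Units.val_mul, e₂, e₃])
  obtain rfl : g3 = a₃ * a₁ := Units.ext (by rw [h3, Units.val_mul, e₃, e₁])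
  obtain ⟨φ, h0, h4, hr, hsr⟩ := exists_dihedralHom e₁ e₃
  obtain ⟨g, hg, rfl⟩ : ∃ g ∈ Subgroup.closure {a₁ * a₂, a₂ * a₃}, P g = x := by
    rw [← Set.image_pair, ← MonoidHom.map_closure] at hx
    exact hx
  suffices ∃ k ∈ Subgroup.closure {a₁ * a₂, a₂ * a₃}, ∃ n : ℤ,
      k * g * k⁻¹ = (a₁ * a₂) ^ n ∨ k * g * k⁻¹ = (a₂ * a₃) ^ n ∨
        k * g * k⁻¹ = (a₃ * a₁) ^ n by
    obtain ⟨k, hk, n, hn⟩ := this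
    refine ⟨P k, ?_, n, ?_⟩
    · rw [← Set.image_pair, ← MonoidHom.map_closure]
      exact Subgroup.mem_map_of_mem P hk
    · simp only [← map_mul, ← map_inv, ← map_zpow]
      exact hn.imp (congrArg P) (Or.imp (congrArg P) (congrArg P))
  set b : GL (Fin 3) ℂ × ℤˣ := (a₂, -1) with hb
  have hgΓ : (g, (1 : ℤˣ)) ∈ Subgroup.closure (Set.range φ ∪ {b}) := by
    have m₁ : (a₁, -1) ∈ Subgroup.closure (Set.range φ ∪ {b}) :=
      Subgroup.subset_closure (Or.inl ⟨_, h0⟩)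
    have m₃ : (a₃, -1) ∈ Subgroup.closure (Set.range φ ∪ {b}) :=
      Subgroup.subset_closure (Or.inl ⟨_, h4⟩)
    have m₂ : b ∈ Subgroup.closure (Set.range φ ∪ {b}) :=
      Subgroup.subset_closure (Or.inr rfl)
    have hle : Subgroup.closure {a₁ * a₂, a₂ * a₃} ≤
        (Subgroup.closure (Set.range φ ∪ {b})).comap (MonoidHom.inl _ ℤˣ) := by
      rw [Subgroup.closure_le]
      rintro _ (rfl | rfl)
      · have e : (a₁ * a₂, (1 : ℤˣ)) = (a₁, -1) * b := Prod.ext rfl (by simp [hb])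
        change (a₁ * a₂, (1 : ℤˣ)) ∈ Subgroup.closure (Set.range φ ∪ {b})
        rw [e]
        exact mul_mem m₁ m₂
      · have e : (a₂ * a₃, (1 : ℤˣ)) = b * (a₃, -1) := Prod.ext rfl (by simp [hb])
        change (a₂ * a₃, (1 : ℤˣ)) ∈ Subgroup.closure (Set.range φ ∪ {b})
        rw [e]
        exact mul_mem m₂ m₃
    exact hle hg
  have hb1 : b * b = 1 := Prod.ext h₂ (by simp [hb])
  have hbr0 : φ (sr 0) * b * φ (sr 0) = b * φ (sr 0) * b := by
    rw [h0]
    refine Prod.ext (Units.ext ?_) (by simp [hb])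
    simp only [hb, Prod.fst_mul, Units.val_mul, e₁, e₂, I1_braid_I2]
  have hbr4 : φ (sr 4) * b * φ (sr 4) = b * φ (sr 4) * b := by
    rw [h4]
    refine Prod.ext (Units.ext ?_) (by simp [hb])
    simp only [hb, Prod.fst_mul, Units.val_mul, e₃, e₂, I3_braid_I2]
  obtain ⟨h, hh, hcases⟩ := exists_conj_reduced hb1 hbr0 hbr4 hgΓ
  have hsnd : (h * (g, 1) * h⁻¹).2 = 1 := by simp
  have hfst : (h * (g, 1) * h⁻¹).1 = h.1 * g * h.1⁻¹ := rfl
  refine exists_conj_zpow h₁ h₂ h₃ (hasParity_of_mem h₁ h₂ h₃ h0 h4 hh) ?_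
  rw [← hfst]
  rcases hcases with ⟨i | i, hs⟩ | hs | hs | hs | ⟨f, d, hd, hper, hred, hs⟩
  · exact Or.inr (Or.inr ⟨i.val, by rw [hs, hr]⟩)
  · rw [hs, hsr] at hsnd
    exact absurd hsnd (by decide)
  · rw [hs] at hsnd
    change (-1 : ℤˣ) = 1 at hsnd
    exact absurd hsnd (by decide)
  · exact Or.inl (by rw [hs, h0]; rfl)
  · exact Or.inr (Or.inl (by rw [hs, h4]; rfl))
  · exfalso
    obtain ⟨n, hn, hpow⟩ := isOfFinOrder_iff_pow_eq_one.mp hfin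
    rw [← map_pow] at hpow
    have hcen : g ^ n ∈ Subgroup.center (GL (Fin 3) ℂ) := (QuotientGroup.eq_one_iff _).mp hpow
    have hword : word ((MonoidHom.fst _ _).comp φ) a₂ f 0 (d * n) = g ^ n := by
      have e := word_map (MonoidHom.fst _ _) φ b f 0 (d * n)
      rw [word_mul_of_periodic φ b hper, ← hs, conj_pow] at e
      rw [show a₂ = (MonoidHom.fst _ _) b from rfl, ← e]
      change h.1 * g ^ n * h.1⁻¹ = g ^ n
      rw [Subgroup.mem_center_iff.mp hcen, mul_inv_cancel_right]
    obtain ⟨c, hc⟩ := Matrix.GeneralLinearGroup.mem_center_iff_val_mem_range_scalar.mp hcen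
    refine word_mulVec_center_ne (φ := (MonoidHom.fst _ _).comp φ) (b := a₂) ?_ ?_ e₂ hred
      (Nat.mul_pos hd hn) c ?_
    · rw [MonoidHom.comp_apply, h0, ← e₁]; rfl
    · rw [MonoidHom.comp_apply, h4, ← e₃]; rfl
    · rw [hword, ← hc]
      ext i
      simp [mulVec_diagonal]
end
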